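/- arXiv:1610.04558 — 2 statements merged into one kernel-verified Lean document; each statement's English description precedes it below -/
import Mathlib

section
/- For the quadratic Veronese embedding X = P^2 ⊂ P^5 and the sheaf F = O_X(1) (pushed forward to P^5), there is a resolution 0 → O(−4) → O(−2)^{6} → O(−1)^{8} → O^{3} → F → 0 by direct sums of line bundles on P^5. -/
/-!
STATEMENT 12: For the quadratic Veronese embedding `X = P² ⊂ P⁵` and the sheaf
`F = O_X(1)` (pushed forward to `P⁵`) there is a resolution
`0 → O(−4) → O(−2)^6 → O(−1)^8 → O^3 → F → 0` by direct sums of line bundles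
on `P⁵`.

`F` corresponds to the graded module `⊕_{m≥0} Sym^{2m+1} V*` (`dim V = 3`)
over `S = Sym^•(Sym² V*)`, whose syzygies `R_{p,m}` are computed by the Koszul
complex with terms `Λ^p(Sym² V*) ⊗ Sym^{2q+1} V*` (internal degree
`m = p + q`).  The resolution above is equivalent to the graded Betti numbers
being `dim R_{0,0} = 3`, `dim R_{1,1} = 8`, `dim R_{2,2} = 6`,
`dim R_{3,4} = 1`, and all others zero; the conclusion asserts that the
cohomology of the Koszul complex at every position has the corresponding
dimension.  `Sym^q V*` is modelled by the degree-`q` homogeneous component of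
the polynomial ring in 3 variables.
-/

set_option synthInstance.maxHeartbeats 1000000
set_option maxHeartbeats 1000000

open MvPolynomial ExteriorAlgebra

abbrev homPart (k : Type) [Field k] (n q : ℕ) : Submodule k (MvPolynomial (Fin n) k) :=
  MvPolynomial.homogeneousSubmodule (Fin n) k q

abbrev koszulTerm (k : Type) [Field k] (n p q : ℕ) :=
  TensorProduct k (⋀[k]^p (homPart k n 2)) (homPart k n q)

noncomputable instance koszulTermAddCommGroup (k : Type) [Field k] (n p q : ℕ) :
    AddCommGroup (koszulTerm k n p q) := inferInstance

noncomputable instance koszulTermModule (k : Type) [Field k] (n p q : ℕ) :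
    Module k (koszulTerm k n p q) := inferInstance

noncomputable def wedge (k : Type) [Field k] (n p : ℕ) (v : Fin p → homPart k n 2) :
    ⋀[k]^p (homPart k n 2) :=
  ⟨ExteriorAlgebra.ιMulti k p v, ExteriorAlgebra.ιMulti_range k p (Set.mem_range_self v)⟩

noncomputable def mulQuad (k : Type) [Field k] (n : ℕ) {q : ℕ}
    (w : homPart k n 2) (f : homPart k n q) : homPart k n (q + 2) :=
  ⟨w.1 * f.1, by
    have := ((MvPolynomial.mem_homogeneousSubmodule _ _).1 w.2).mul
      ((MvPolynomial.mem_homogeneousSubmodule _ _).1 f.2)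
    exact (MvPolynomial.mem_homogeneousSubmodule _ _).2 (by simpa [add_comm] using this)⟩

/-- The graded Betti numbers of `O_X(1)` for the second Veronese embedding of
`P²`: `B p m = dim R_{p,m}`. -/
def veroneseP2TwistBetti : ℕ → ℕ → ℕ := fun p m =>
  match p, m with
  | 0, 0 => 3
  | 1, 1 => 8
  | 2, 2 => 6
  | 3, 4 => 1
  | _, _ => 0


namespace VerAux

/-- monomials of degree `n` -/
abbrev Mon (n : ℕ) := {m : Fin 3 →₀ ℕ // m.degree = n}

instance monFinite (n : ℕ) : Finite (Mon n) := by
  have : Function.Injective (fun m : Mon n => (fun i => (⟨m.1 i, by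
      have := Finsupp.le_degree i m.1
      have := m.2
      omega⟩ : Fin (n+1)) : Fin 3 → Fin (n+1))) := by
    intro a b h
    apply Subtype.ext
    ext i
    have := congrFun h i
    simpa using this
  exact Finite.of_injective _ this

noncomputable instance monFintype (n : ℕ) : Fintype (Mon n) := Fintype.ofFinite _

noncomputable def monVec (k : Type) [Field k] (n : ℕ) (m : Mon n) : homPart k 3 n :=
  ⟨monomial m.1 1, (mem_homogeneousSubmodule _ _).2 (isHomogeneous_monomial _ m.2)⟩

noncomputable def monBasis (k : Type) [Field k] (n : ℕ) :
    Module.Basis (Mon n) k (homPart k 3 n) :=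
  Module.Basis.mk (v := monVec k n) (by
    apply LinearIndependent.of_comp (homPart k 3 n).subtype
    have h := (basisMonomials (Fin 3) k).linearIndependent.comp
      (fun m : Mon n => m.1) Subtype.val_injective
    have h2 : LinearIndependent k
        (fun m : Mon n => (monomial m.1 1 : MvPolynomial (Fin 3) k)) := by
      simpa [Function.comp_def] using h
    exact h2) (by
    rintro ⟨f, hf⟩ -
    have hf' := (mem_homogeneousSubmodule _ _).1 hf
    have : (⟨f, hf⟩ : homPart k 3 n) = ∑ m ∈ f.support.attach, 
        f.coeff m.1 • monVec k n ⟨m.1, by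
          have := hf' (mem_support_iff.1 m.2)
          rwa [Finsupp.degree_eq_weight_one]⟩ := by
      apply Subtype.ext
      rw [AddSubmonoidClass.coe_finsetSum]
      simp only [monVec, Submodule.coe_smul, smul_monomial, smul_eq_mul, mul_one]
      rw [Finset.sum_attach f.support (fun m => monomial m (coeff m f))]
      exact f.as_sum
    rw [this]
    exact Submodule.sum_mem _ (fun m _ => Submodule.smul_mem _ _
      (Submodule.subset_span ⟨_, rfl⟩)))

lemma monBasis_apply (k : Type) [Field k] (n : ℕ) (m : Mon n) :
    monBasis k n m = monVec k n m := by simp [monBasis]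

/-- exponents of the six quadratic monomials -/
def tab : Fin 6 → Fin 3 → ℕ :=
  ![![2,0,0],![0,2,0],![0,0,2],![1,1,0],![0,1,1],![1,0,1]]

noncomputable def qe (i : Fin 6) : Mon 2 :=
  ⟨Finsupp.equivFunOnFinite.symm (tab i), by
    rw [Finsupp.degree_eq_sum]
    fin_cases i <;> simp [tab, Fin.sum_univ_three]⟩

lemma mon_sum {n : ℕ} (m : Mon n) : m.1 0 + m.1 1 + m.1 2 = n := by
  have := m.2
  rw [Finsupp.degree_eq_sum, Fin.sum_univ_three] at this
  exact this

lemma qe_apply (i : Fin 6) (j : Fin 3) : (qe i).1 j = tab i j := rfl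

lemma mon_ext {n : ℕ} {m m' : Mon n} (h0 : m.1 0 = m'.1 0) (h1 : m.1 1 = m'.1 1)
    (h2 : m.1 2 = m'.1 2) : m = m' := by
  apply Subtype.ext
  ext i
  fin_cases i <;> assumption

lemma qe_bij : Function.Bijective qe := by
  constructor
  · intro i j h
    have h0 : tab i = tab j := by
      funext l
      rw [← qe_apply, ← qe_apply, h]
    clear h
    revert i j
    decide
  · intro m
    have h := mon_sum m
    have : ∃ i : Fin 6, tab i 0 = m.1 0 ∧ tab i 1 = m.1 1 ∧ tab i 2 = m.1 2 := by
      generalize m.1 0 = a at *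
      generalize m.1 1 = b at *
      generalize m.1 2 = c at *
      have ha : a ≤ 2 := by omega
      have hb : b ≤ 2 := by omega
      obtain rfl : c = 2 - a - b := by omega
      interval_cases a <;> interval_cases b <;> first | omega | decide
    obtain ⟨i, h0, h1, h2⟩ := this
    exact ⟨i, mon_ext h0 h1 h2⟩

noncomputable def quadBasis (k : Type) [Field k] : Module.Basis (Fin 6) k (homPart k 3 2) :=
  (monBasis k 2).reindex (Equiv.ofBijective qe qe_bij).symm

lemma quadBasis_apply (k : Type) [Field k] (i : Fin 6) :
    quadBasis k i = monVec k 2 (qe i) := by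
  simp [quadBasis, monBasis_apply]

abbrev Cell (p q : ℕ) := Set.powersetCard (Fin 6) p × Mon (2 * q + 1)

noncomputable def kBasis (k : Type) [Field k] (p n : ℕ) :
    Module.Basis (Set.powersetCard (Fin 6) p × Mon n) k (koszulTerm k 3 p n) :=
  ((quadBasis k).exteriorPower p).tensorProduct (monBasis k n)

open Set.powersetCard in
lemma kBasis_apply (k : Type) [Field k] (p n : ℕ) (c : Set.powersetCard (Fin 6) p × Mon n) :
    kBasis k p n c = TensorProduct.tmul k
      (wedge k 3 p (quadBasis k ∘ (ofFinEmbEquiv.symm c.1))) (monVec k n c.2) := by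
  obtain ⟨s, m⟩ := c
  rw [kBasis, Module.Basis.tensorProduct_apply, exteriorPower.basis_apply, monBasis_apply]
  rfl

/-- the product of monomials -/
noncomputable def madd {n : ℕ} (i : Fin 6) (m : Mon n) : Mon (n + 2) :=
  ⟨m.1 + (qe i).1, by rw [map_add, m.2, (qe i).2]⟩

lemma mulQuad_mon (k : Type) [Field k] {n : ℕ} (i : Fin 6) (m : Mon n) :
    mulQuad k 3 (quadBasis k i) (monVec k n m) = monVec k (n + 2) (madd i m) := by
  apply Subtype.ext
  simp [mulQuad, quadBasis_apply, monVec, madd, monomial_mul, add_comm]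

/-- remove the `i`-th element -/
def face {p : ℕ} (s : Set.powersetCard (Fin 6) (p + 1)) (i : Fin (p + 1)) :
    Set.powersetCard (Fin 6) p :=
  Set.powersetCard.ofFinEmbEquiv
    ((Fin.succAboveOrderEmb i).trans (Set.powersetCard.ofFinEmbEquiv.symm s))

lemma face_val {p : ℕ} (s : Set.powersetCard (Fin 6) (p + 1)) (i : Fin (p + 1)) :
    (face s i).1 = s.1.erase (Set.powersetCard.ofFinEmbEquiv.symm s i) := by
  ext x
  have h1 : x ∈ (face s i).1 ↔ x ∈ face s i := Iff.rfl
  rw [h1, face, Set.powersetCard.mem_ofFinEmbEquiv_iff_mem_range, Finset.mem_erase]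
  have h2 : x ∈ s.1 ↔ x ∈ s := Iff.rfl
  rw [h2, ← Set.powersetCard.mem_range_ofFinEmbEquiv_symm_iff_mem]
  constructor
  · rintro ⟨j, rfl⟩
    refine ⟨?_, ⟨i.succAbove j, rfl⟩⟩
    intro h
    exact Fin.succAbove_ne i j ((Set.powersetCard.ofFinEmbEquiv.symm s).injective h)
  · rintro ⟨hx, ⟨j, rfl⟩⟩
    have : j ≠ i := fun h => hx (by rw [h])
    obtain ⟨l, rfl⟩ := Fin.exists_succAbove_eq this
    exact ⟨l, rfl⟩

section
variable (k : Type) [Field k]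
    (d : ∀ p q : ℕ, koszulTerm k 3 (p + 1) (2 * q + 1) →ₗ[k] koszulTerm k 3 p (2 * q + 3))

/-- the hypothesis that `d` is the Koszul differential -/
abbrev IsKoszul : Prop :=
  ∀ (p q : ℕ) (v : Fin (p + 1) → homPart k 3 2) (f : homPart k 3 (2 * q + 1)),
      d p q (TensorProduct.tmul k (wedge k 3 (p + 1) v) f) =
        ∑ i : Fin (p + 1), ((-1 : k) ^ (i : ℕ)) •
          TensorProduct.tmul k (wedge k 3 p (fun j => v (i.succAbove j)))
            (mulQuad k 3 (v i) f)

lemma d_basis (hd : IsKoszul k d) (p q : ℕ) (c : Cell (p + 1) q) :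
    d p q (kBasis k (p + 1) (2 * q + 1) c) = ∑ i : Fin (p + 1), ((-1 : k) ^ (i : ℕ)) •
      kBasis k p (2 * q + 3)
        (face c.1 i, madd (Set.powersetCard.ofFinEmbEquiv.symm c.1 i) c.2) := by
  rw [kBasis_apply, hd]
  refine Finset.sum_congr rfl fun i _ => ?_
  congr 1
  rw [kBasis_apply, Function.comp_apply, mulQuad_mon]
  simp only [face, Equiv.symm_apply_apply]
  rfl

lemma coef (hd : IsKoszul k d) (p q : ℕ) (c : Cell (p + 1) q) (c' : Set.powersetCard (Fin 6) p × Mon (2 * q + 3)) :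
    (kBasis k p (2 * q + 3)).repr (d p q (kBasis k (p + 1) (2 * q + 1) c)) c' =
      ∑ i : Fin (p + 1), ((-1 : k) ^ (i : ℕ)) * 
       (Finsupp.single (face c.1 i, madd (Set.powersetCard.ofFinEmbEquiv.symm c.1 i) c.2) 1 :
         (Set.powersetCard (Fin 6) p × Mon (2 * q + 3)) →₀ k) c' := by
  rw [d_basis k d hd, map_sum, Finsupp.finsetSum_apply]
  refine Finset.sum_congr rfl fun i _ => ?_
  rw [map_smul, Module.Basis.repr_self, Finsupp.smul_apply, smul_eq_mul]

lemma coef_exists (hd : IsKoszul k d) (p q : ℕ) (c : Cell (p + 1) q)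
    (c' : Set.powersetCard (Fin 6) p × Mon (2 * q + 3))
    (h : (kBasis k p (2 * q + 3)).repr (d p q (kBasis k (p + 1) (2 * q + 1) c)) c' ≠ 0) :
    ∃ i ∈ c.1.1, c'.1.1 = c.1.1.erase i ∧ c'.2 = madd i c.2 := by
  rw [coef k d hd] at h
  obtain ⟨i, -, hi⟩ := Finset.exists_ne_zero_of_sum_ne_zero h
  have := right_ne_zero_of_mul hi
  rw [Finsupp.single_apply] at this
  have h2 := (ite_ne_right_iff.1 this).1
  subst h2
  exact ⟨_, (Set.powersetCard.mem_range_ofFinEmbEquiv_symm_iff_mem c.1 _).1 ⟨i, rfl⟩,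
    face_val _ _, rfl⟩

lemma coef_ne (hd : IsKoszul k d) (p q : ℕ) (c : Cell (p + 1) q)
    (c' : Set.powersetCard (Fin 6) p × Mon (2 * q + 3))
    (i : Fin 6) (hi : i ∈ c.1.1) (h1 : c'.1.1 = c.1.1.erase i) (h2 : c'.2 = madd i c.2) :
    (kBasis k p (2 * q + 3)).repr (d p q (kBasis k (p + 1) (2 * q + 1) c)) c' ≠ 0 := by
  rw [coef k d hd]
  obtain ⟨j, rfl⟩ := (Set.powersetCard.mem_range_ofFinEmbEquiv_symm_iff_mem c.1 i).2 hi
  have hc : c' = (face c.1 j, madd (Set.powersetCard.ofFinEmbEquiv.symm c.1 j) c.2) := by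
    refine Prod.ext (Subtype.ext ?_) h2
    rw [h1, face_val]
  rw [Finset.sum_eq_single j]
  · rw [hc, Finsupp.single_eq_same]
    simp
  · intro l _ hl
    rw [Finsupp.single_apply, if_neg, mul_zero]
    intro he
    apply hl
    have h3 := congrArg (fun x => x.1.1) he
    simp only at h3
    rw [face_val, h1] at h3
    have h4 := Finset.erase_injOn c.1.1 ((Set.powersetCard.mem_range_ofFinEmbEquiv_symm_iff_mem c.1 _).1 ⟨l, rfl⟩) hi h3
    exact (Set.powersetCard.ofFinEmbEquiv.symm c.1).injective h4
  · simp

lemma dd_zero (hd : IsKoszul k d) (p q : ℕ) (x : koszulTerm k 3 (p + 1 + 1) (2 * q + 1)) :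
    d p (q + 1) (d (p + 1) q x) = 0 := by
  suffices h : (d p (q + 1)) ∘ₗ (d (p + 1) q) = 0 by
    exact LinearMap.congr_fun h x
  apply (kBasis k (p + 1 + 1) (2 * q + 1)).ext
  intro c
  rw [kBasis_apply]
  generalize quadBasis k ∘ (Set.powersetCard.ofFinEmbEquiv.symm c.1) = v
  generalize monVec k _ c.2 = f
  rw [LinearMap.comp_apply, hd, map_sum]
  have : ∀ i : Fin (p + 1 + 1), d p (q + 1) (((-1 : k) ^ (i : ℕ)) •
          TensorProduct.tmul k (wedge k 3 (p + 1) (fun j => v (i.succAbove j)))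
            (mulQuad k 3 (v i) f)) = ∑ j : Fin (p + 1), ((-1 : k) ^ (i : ℕ)) • ((-1 : k) ^ (j : ℕ)) •
            TensorProduct.tmul k (wedge k 3 p (fun l => v (i.succAbove (j.succAbove l))))
            (mulQuad k 3 (v (i.succAbove j)) (mulQuad k 3 (v i) f)) := by
    intro i
    rw [map_smul]
    erw [hd p (q+1)]
    rw [Finset.smul_sum]
  simp only [this]
  rw [Fin.sum_sum_eq_sum_triangle_add]
  refine Finset.sum_eq_zero fun i _ => Finset.sum_eq_zero fun j hj => ?_
  rw [Finset.mem_Ici] at hj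
  have H₁ : i.castSucc.succAbove j = j.succ := by
    simp [Fin.succAbove_of_le_castSucc, hj]
  have H₂ : j.succ.succAbove i = i.castSucc := by
    simp [Fin.succAbove_of_castSucc_lt, hj]
  have H3 : ∀ l, j.succ.succAbove (i.succAbove l) = i.castSucc.succAbove (j.succAbove l) := by
    intro l
    rw [← Fin.succAbove_succAbove_succAbove_predAbove i.castSucc j l, H₁]
    congr 2
    simp [Fin.predAbove, hj]
  have H4 : mulQuad k 3 (v i.castSucc) (mulQuad k 3 (v j.succ) f) =
     mulQuad k 3 (v j.succ) (mulQuad k 3 (v i.castSucc) f) := by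
    apply Subtype.ext
    simp only [mulQuad]
    ring
  simp only [H₁, H₂, H3, H4, smul_smul]
  rw [← add_smul]
  have : (-1 : k) ^ (i.castSucc : ℕ) * (-1) ^ (j : ℕ) + (-1) ^ (j.succ : ℕ) * (-1) ^ (i : ℕ) = 0 := by
    simp only [Fin.val_castSucc, Fin.val_succ, pow_succ]
    ring
  rw [this, zero_smul]

end

set_option synthInstance.maxSize 100000

lemma rank_ge {k V W ι κ : Type*} [Field k] [AddCommGroup V] [Module k V] [AddCommGroup W]
    [Module k W] [Module.Finite k W] (b : Module.Basis ι k V) (b' : Module.Basis κ k W)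
    (f : V →ₗ[k] W) (U : Finset ι) (π : U → κ) (st : U → ℕ)
    (h1 : ∀ u : U, b'.repr (f (b u)) (π u) ≠ 0)
    (h2 : ∀ u u' : U, u' ≠ u → b'.repr (f (b u')) (π u) ≠ 0 → st u < st u') :
    U.card ≤ Module.finrank k (LinearMap.range f) := by
  have hli : LinearIndependent k (fun u : U => f (b u)) := by
    rw [Fintype.linearIndependent_iff]
    intro g hg
    by_contra! hne
    obtain ⟨u0, hu0⟩ := hne
    classical
    obtain ⟨u, hu, hmax⟩ := Finset.exists_max_image (Finset.univ.filter fun u => g u ≠ 0) st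
      ⟨u0, by simpa using hu0⟩
    have hgu : g u ≠ 0 := by simpa using hu
    have h3 := congrArg (fun w => b'.repr w (π u)) hg
    simp only [map_sum, map_smul, Finsupp.finsetSum_apply, Finsupp.smul_apply, smul_eq_mul,
      map_zero, Finsupp.zero_apply] at h3
    rw [Finset.sum_eq_single u] at h3
    · exact mul_ne_zero hgu (h1 u) h3
    · intro u' _ hne
      by_contra h4
      have h5 := h2 u u' hne (right_ne_zero_of_mul h4)
      have h6 := hmax u' (by simpa using left_ne_zero_of_mul h4)
      omega
    · simp
  have hli2 : LinearIndependent k (fun u : U => (⟨f (b u), ⟨_, rfl⟩⟩ : LinearMap.range f)) :=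
    LinearIndependent.of_comp (LinearMap.range f).subtype hli
  have := hli2.fintype_card_le_finrank
  simpa using this

/-- lower cells of the matching -/
abbrev Lo (i : Fin 6) (t : Finset (Fin 6)) (a b c : ℕ) : Prop :=
  (i = 0 ∧ 0 ∉ t ∧ 2 ≤ a) ∨
  (i = 1 ∧ 0 ∉ t ∧ a < 2 ∧ 1 ∉ t ∧ 2 ≤ b) ∨
  (i = 2 ∧ 0 ∉ t ∧ a < 2 ∧ 1 ∉ t ∧ b < 2 ∧ 2 ∉ t ∧ 2 ≤ c) ∨
  (i = 3 ∧ 0 ∉ t ∧ 1 ∉ t ∧ 2 ∉ t ∧ a = 1 ∧ b = 1 ∧ c = 1 ∧ 3 ∉ t) ∨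
  (i = 4 ∧ 0 ∉ t ∧ 1 ∉ t ∧ 2 ∉ t ∧ a = 1 ∧ b = 1 ∧ c = 1 ∧ 3 ∈ t ∧ 4 ∉ t) ∨
  (i = 5 ∧ 0 ∉ t ∧ 1 ∉ t ∧ 2 ∉ t ∧ a = 1 ∧ b = 1 ∧ c = 1 ∧ 3 ∈ t ∧ 4 ∈ t ∧ 5 ∉ t)

/-- upper cells of the matching -/
abbrev Up (i : Fin 6) (s : Finset (Fin 6)) (a b c : ℕ) : Prop :=
  i ∈ s ∧ Lo i (s.erase i) (a + tab i 0) (b + tab i 1) (c + tab i 2)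

lemma lo_unique {i j : Fin 6} {t : Finset (Fin 6)} {a b c : ℕ} (h : Lo i t a b c)
    (h' : Lo j t a b c) : i = j := by
  rcases h with h | h | h | h | h | h <;> rcases h' with h' | h' | h' | h' | h' | h' <;>
    obtain ⟨rfl, h⟩ := h <;> obtain ⟨rfl, h'⟩ := h' <;> first | rfl | (exfalso; tauto) | (exfalso; omega)

lemma lo_notMem {i : Fin 6} {t : Finset (Fin 6)} {a b c : ℕ} (h : Lo i t a b c) : i ∉ t := by
  rcases h with h | h | h | h | h | h <;> obtain ⟨rfl, h⟩ := h <;> tauto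

lemma lo_le {i : Fin 6} {t : Finset (Fin 6)} {a b c : ℕ} (h : Lo i t a b c) :
    tab i 0 ≤ a ∧ tab i 1 ≤ b ∧ tab i 2 ≤ c := by
  rcases h with h | h | h | h | h | h <;> obtain ⟨rfl, h⟩ := h <;> simp [tab] <;> omega

lemma up_iff {i : Fin 6} {s : Finset (Fin 6)} {a b c : ℕ} : Up i s a b c ↔
  ((i = 0 ∧ 0 ∈ s) ∨
  (i = 1 ∧ 0 ∉ s ∧ a < 2 ∧ 1 ∈ s) ∨
  (i = 2 ∧ 0 ∉ s ∧ a < 2 ∧ 1 ∉ s ∧ b < 2 ∧ 2 ∈ s) ∨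
  (i = 3 ∧ 0 ∉ s ∧ 1 ∉ s ∧ 2 ∉ s ∧ a = 0 ∧ b = 0 ∧ c = 1 ∧ 3 ∈ s) ∨
  (i = 4 ∧ 0 ∉ s ∧ 1 ∉ s ∧ 2 ∉ s ∧ a = 1 ∧ b = 0 ∧ c = 0 ∧ 3 ∈ s ∧ 4 ∈ s) ∨
  (i = 5 ∧ 0 ∉ s ∧ 1 ∉ s ∧ 2 ∉ s ∧ a = 0 ∧ b = 1 ∧ c = 0 ∧ 3 ∈ s ∧ 4 ∈ s ∧ 5 ∈ s)) := by
  fin_cases i <;> simp [Up, Lo, tab] <;> tauto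

lemma up_unique {i j : Fin 6} {t : Finset (Fin 6)} {a b c : ℕ} (h : Up i t a b c)
    (h' : Up j t a b c) : i = j := by
  rw [up_iff] at h h'
  rcases h with h | h | h | h | h | h <;> rcases h' with h' | h' | h' | h' | h' | h' <;>
    obtain ⟨rfl, h⟩ := h <;> obtain ⟨rfl, h'⟩ := h' <;> first | rfl | (exfalso; tauto) | (exfalso; omega)

lemma up_not_lo {i j : Fin 6} {t : Finset (Fin 6)} {a b c : ℕ} (h : Up i t a b c)
    (h' : Lo j t a b c) : False := by
  rw [up_iff] at h
  rcases h with h | h | h | h | h | h <;> rcases h' with h' | h' | h' | h' | h' | h' <;>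
    obtain ⟨rfl, h⟩ := h <;> obtain ⟨rfl, h'⟩ := h' <;> first | (tauto) | (omega)

/-- stage of the matching -/
def stage (i : Fin 6) : ℕ := min i.val 3

lemma tri {i j l : Fin 6} {t : Finset (Fin 6)} {a b c a' b' c' : ℕ} (h : Lo i t a b c)
    (hj : j ∉ t) (hij : j ≠ i) (ha : a = a' + tab j 0) (hb : b = b' + tab j 1)
    (hc : c = c' + tab j 2) (hu : Up l (insert j t) a' b' c') : stage i < stage l := by
  rw [up_iff] at hu
  simp only [Finset.mem_insert] at hu
  subst ha hb hc
  rcases h with h | h | h | h | h | h <;> obtain ⟨rfl, h⟩ := h <;> 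
  rcases hu with h' | h' | h' | h' | h' | h' <;> obtain ⟨rfl, h'⟩ := h' <;>
  first
  | (simp [stage]; done)
  | (exfalso; revert j; intro j; fin_cases j <;> simp [tab] <;> first | omega | tauto)

abbrev Crit (s : Finset (Fin 6)) (a b c : ℕ) : Prop :=
  (∀ i, ¬ Lo i s a b c) ∧ (∀ i, ¬ Up i s a b c)

lemma crit_le {s : Finset (Fin 6)} {a b c : ℕ} (h : Crit s a b c) : a < 2 ∧ b < 2 ∧ c < 2 := by
  obtain ⟨h1, h2⟩ := h
  have l0 := h1 0
  have l1 := h1 1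
  have l2 := h1 2
  have u0 := h2 0
  have u1 := h2 1
  have u2 := h2 2
  rw [up_iff] at u0 u1 u2
  simp [Lo] at l0 l1 l2 u0 u1 u2
  have := l0 u0
  have := u1 u0 this
  have := l1 u0 ‹_› ‹_›
  have := u2 u0 ‹_› ‹_› ‹_›
  have := l2 u0 ‹_› ‹_› ‹_› ‹_›
  omega

def critSet (p q : ℕ) : Finset (Finset (Fin 6) × ℕ × ℕ × ℕ) :=
  ((Finset.powersetCard p Finset.univ) ×ˢ Finset.range 2 ×ˢ Finset.range 2 ×ˢ Finset.range 2).filter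
    (fun x => x.2.1 + x.2.2.1 + x.2.2.2 = 2 * q + 1 ∧ Crit x.1 x.2.1 x.2.2.1 x.2.2.2)

lemma critSet_card (p q : ℕ) : (critSet p q).card = veroneseP2TwistBetti p (p + q) := by
  by_cases hp : p ≤ 6
  · by_cases hq : q ≤ 1
    · interval_cases p <;> interval_cases q <;> decide +kernel
    · have : critSet p q = ∅ := by
        rw [critSet, Finset.filter_eq_empty_iff]
        rintro ⟨s, a, b, c⟩ h ⟨h', -⟩
        simp only [Finset.mem_product, Finset.mem_range] at h h'
        omega
      rw [this]
      unfold veroneseP2TwistBetti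
      split <;> first | rfl | omega
  · have : critSet p q = ∅ := by
      rw [critSet, Finset.powersetCard_eq_empty.2 (by simp; omega)]
      simp
    rw [this]
    unfold veroneseP2TwistBetti
    split <;> first | rfl | omega

noncomputable instance cellFintype (p q : ℕ) : Fintype (Cell p q) := Fintype.ofFinite _

open Classical in
noncomputable def Uset (p q : ℕ) : Finset (Cell p q) :=
  Finset.univ.filter fun c => ∃ i, Up i c.1.1 (c.2.1 0) (c.2.1 1) (c.2.1 2)

open Classical in
noncomputable def Lset (p q : ℕ) : Finset (Cell p q) :=
  Finset.univ.filter fun c => ∃ i, Lo i c.1.1 (c.2.1 0) (c.2.1 1) (c.2.1 2)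

open Classical in
noncomputable def Cset (p q : ℕ) : Finset (Cell p q) :=
  Finset.univ.filter fun c => Crit c.1.1 (c.2.1 0) (c.2.1 1) (c.2.1 2)

lemma card_split (p q : ℕ) :
    Fintype.card (Cell p q) = (Uset p q).card + (Lset p q).card + (Cset p q).card := by
  classical
  rw [← Finset.card_union_of_disjoint, ← Finset.card_union_of_disjoint, ← Finset.card_univ]
  · congr 1
    ext c
    simp only [Uset, Lset, Cset, Finset.mem_union, Finset.mem_filter, Finset.mem_univ, true_and,
      true_iff, Crit, ← not_exists]
    generalize (∃ i, Up i c.1.1 (c.2.1 0) (c.2.1 1) (c.2.1 2)) = P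
    generalize (∃ i, Lo i c.1.1 (c.2.1 0) (c.2.1 1) (c.2.1 2)) = Q
    tauto
  · rw [Finset.disjoint_left]
    intro c
    simp only [Uset, Lset, Cset, Finset.mem_union, Finset.mem_filter, Finset.mem_univ, true_and,
      Crit]
    rintro (⟨i, hi⟩ | ⟨i, hi⟩) ⟨h1, h2⟩
    · exact h2 i hi
    · exact h1 i hi
  · rw [Finset.disjoint_left]
    intro c
    simp only [Uset, Lset, Finset.mem_filter, Finset.mem_univ, true_and]
    rintro ⟨i, hi⟩ ⟨j, hj⟩
    exact up_not_lo hi hj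

lemma Cset_card (p q : ℕ) : (Cset p q).card = veroneseP2TwistBetti p (p + q) := by
  rw [← critSet_card]
  refine Finset.card_bij (fun c _ => (c.1.1, c.2.1 0, c.2.1 1, c.2.1 2)) ?_ ?_ ?_
  · intro c hc
    have h : Crit c.1.1 (c.2.1 0) (c.2.1 1) (c.2.1 2) := by
      simpa only [Cset, Finset.mem_filter, Finset.mem_univ, true_and] using hc
    have h2 := crit_le h
    simp only [critSet, Finset.mem_filter, Finset.mem_product, Finset.mem_range,
      Finset.mem_powersetCard]
    exact ⟨⟨⟨Finset.subset_univ _, c.1.2⟩, h2⟩, mon_sum c.2, h⟩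
  · rintro ⟨s, m⟩ _ ⟨s', m'⟩ _ h
    simp only [Prod.mk.injEq] at h
    obtain ⟨h1, h2, h3, h4⟩ := h
    exact Prod.ext (Subtype.ext h1) (mon_ext h2 h3 h4)
  · rintro ⟨s, a, b, c⟩ h
    simp only [critSet, Finset.mem_filter, Finset.mem_product, Finset.mem_range,
      Finset.mem_powersetCard] at h
    refine ⟨(⟨s, h.1.1.2⟩, ⟨Finsupp.equivFunOnFinite.symm ![a, b, c], ?_⟩), ?_, ?_⟩
    · rw [Finsupp.degree_eq_sum, Fin.sum_univ_three]
      exact h.2.1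
    · simp only [Cset, Finset.mem_filter, Finset.mem_univ, true_and]
      exact h.2.2
    · rfl

/-- pairing of upper cells with lower cells -/
lemma exists_partner {p q : ℕ} (c : Cell (p + 1) q) (hc : c ∈ Uset (p + 1) q) :
    ∃ (i : Fin 6) (c' : Cell p (q + 1)), i ∈ c.1.1 ∧
      Up i c.1.1 (c.2.1 0) (c.2.1 1) (c.2.1 2) ∧
      Lo i c'.1.1 (c'.2.1 0) (c'.2.1 1) (c'.2.1 2) ∧
      c'.1.1 = c.1.1.erase i ∧ c'.2 = madd i c.2 := by
  simp only [Uset, Finset.mem_filter, Finset.mem_univ, true_and] at hc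
  obtain ⟨i, hi⟩ := hc
  refine ⟨i, (⟨c.1.1.erase i, ?_⟩, madd i c.2), hi.1, hi, ?_, rfl, rfl⟩
  · show (c.1.1.erase i).card = p
    rw [Finset.card_erase_of_mem hi.1]
    have : c.1.1.card = p + 1 := c.1.2
    omega
  · exact hi.2

lemma madd_inj {n : ℕ} {i : Fin 6} {m m' : Mon n} (h : madd i m = madd i m') : m = m' := by
  have := congrArg Subtype.val h
  exact Subtype.ext (add_right_cancel this)

lemma UL_card (p q : ℕ) : (Uset (p + 1) q).card = (Lset p (q + 1)).card := by
  choose i π h1 h2 h3 h4 h5 using @exists_partner p q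
  refine Finset.card_bij π ?_ ?_ ?_
  · intro c hc
    simp only [Lset, Finset.mem_filter, Finset.mem_univ, true_and]
    exact ⟨_, h3 c hc⟩
  · intro c hc c' hc' h
    have hi : i c hc = i c' hc' := by
      have := h3 c hc
      rw [h] at this
      exact lo_unique this (h3 c' hc')
    refine Prod.ext (Subtype.ext ?_) ?_
    · rw [← Finset.insert_erase (h1 c hc), ← Finset.insert_erase (h1 c' hc'), ← h4, ← h4, h, hi]
    · apply madd_inj (i := i c hc)
      rw [← h5, h, h5, hi]
  · intro c hc
    simp only [Lset, Finset.mem_filter, Finset.mem_univ, true_and] at hc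
    obtain ⟨j, hj⟩ := hc
    have hle := lo_le hj
    have hjm := lo_notMem hj
    have hs := mon_sum c.2
    have htab : tab j 0 + tab j 1 + tab j 2 = 2 := mon_sum (qe j)
    let m : Mon (2 * q + 1) := ⟨Finsupp.equivFunOnFinite.symm 
      ![c.2.1 0 - tab j 0, c.2.1 1 - tab j 1, c.2.1 2 - tab j 2], by
        rw [Finsupp.degree_eq_sum, Fin.sum_univ_three]
        show c.2.1 0 - tab j 0 + (c.2.1 1 - tab j 1) + (c.2.1 2 - tab j 2) = _
        omega⟩
    have e0 : m.1 0 + tab j 0 = c.2.1 0 := Nat.sub_add_cancel hle.1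
    have e1 : m.1 1 + tab j 1 = c.2.1 1 := Nat.sub_add_cancel hle.2.1
    have e2 : m.1 2 + tab j 2 = c.2.1 2 := Nat.sub_add_cancel hle.2.2
    let u : Cell (p + 1) q := (⟨insert j c.1.1, by
      show (insert j c.1.1).card = p + 1
      rw [Finset.card_insert_of_notMem hjm]
      congr 1
      exact c.1.2⟩, m)
    have hu : Up j u.1.1 (u.2.1 0) (u.2.1 1) (u.2.1 2) := by
      refine ⟨Finset.mem_insert_self _ _, ?_⟩
      show Lo j ((insert j c.1.1).erase j) (m.1 0 + tab j 0) (m.1 1 + tab j 1) (m.1 2 + tab j 2)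
      rw [Finset.erase_insert hjm, e0, e1, e2]
      exact hj
    have huU : u ∈ Uset (p + 1) q := by
      simp only [Uset, Finset.mem_filter, Finset.mem_univ, true_and]
      exact ⟨j, hu⟩
    have hij : i u huU = j := up_unique (h2 u huU) hu
    refine ⟨u, huU, Prod.ext (Subtype.ext ?_) ?_⟩
    · rw [h4, hij]
      exact Finset.erase_insert hjm
    · rw [h5, hij]
      exact mon_ext e0 e1 e2

lemma U_zero (q : ℕ) : (Uset 0 q).card = 0 := by
  classical
  rw [Finset.card_eq_zero, Uset, Finset.filter_eq_empty_iff]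
  rintro ⟨s, m⟩ _ ⟨i, hi⟩
  have h : s.1.card = 0 := s.2
  rw [Finset.card_eq_zero] at h
  have := hi.1
  simp [h] at this

lemma L_zero (p : ℕ) : (Lset p 0).card = 0 := by
  classical
  rw [Finset.card_eq_zero, Lset, Finset.filter_eq_empty_iff]
  rintro ⟨s, m⟩ _ ⟨i, hi⟩
  have h1 := lo_le hi
  have h2 := mon_sum m
  have htab : tab i 0 + tab i 1 + tab i 2 = 2 := mon_sum (qe i)
  simp only at h1
  omega

lemma dim_eq (k : Type) [Field k] (p q : ℕ) :
    Module.finrank k (koszulTerm k 3 p (2 * q + 1)) = Fintype.card (Cell p q) :=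
  Module.finrank_eq_card_basis (kBasis k p (2 * q + 1))

instance koszulFinite (k : Type) [Field k] (p n : ℕ) : Module.Finite k (koszulTerm k 3 p n) :=
  Module.Finite.of_basis (kBasis k p n)

section
variable (k : Type) [Field k]
    (d : ∀ p q : ℕ, koszulTerm k 3 (p + 1) (2 * q + 1) →ₗ[k] koszulTerm k 3 p (2 * q + 3))

lemma ker_eq (p q : ℕ) : Module.finrank k (LinearMap.range (d p q)) +
    Module.finrank k (LinearMap.ker (d p q)) = Fintype.card (Cell (p + 1) q) := by
  rw [← dim_eq k]
  exact LinearMap.finrank_range_add_finrank_ker (d p q)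


lemma rank_lower (hd : IsKoszul k d) (p q : ℕ) :
    (Uset (p + 1) q).card ≤ Module.finrank k (LinearMap.range (d p q)) := by
  choose i π h1 h2 h3 h4 h5 using @exists_partner p q
  refine rank_ge (kBasis k (p + 1) (2 * q + 1)) (kBasis k p (2 * q + 3)) (d p q) (Uset (p + 1) q)
    (fun u => π u.1 u.2) (fun u => stage (i u.1 u.2)) ?_ ?_
  · rintro ⟨u, hu⟩
    exact coef_ne k d hd p q u _ (i u hu) (h1 u hu) (h4 u hu) (h5 u hu)
  · rintro ⟨u, hu⟩ ⟨u', hu'⟩ hne h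
    obtain ⟨j, hj, e1, e2⟩ := coef_exists k d hd p q u' _ h
    simp only at e1 e2 ⊢
    have e1' : insert j (π u hu).1.1 = u'.1.1 := by rw [e1, Finset.insert_erase hj]
    refine tri (j := j) (h3 u hu) (by rw [e1]; simp) ?_
      (congrArg (fun m => m.1 0) e2) (congrArg (fun m => m.1 1) e2) (congrArg (fun m => m.1 2) e2)
      (by rw [e1']; exact h2 u' hu')
    rintro rfl
    apply hne
    apply Subtype.ext
    refine Prod.ext (Subtype.ext ?_) ?_
    · show u'.1.1 = u.1.1
      rw [← e1', h4, Finset.insert_erase (h1 u hu)]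
    · apply madd_inj (i := i u hu)
      exact e2.symm.trans (h5 u hu)

lemma rank_sum (hd : IsKoszul k d) (p q : ℕ) : Module.finrank k (LinearMap.range (d p (q + 1))) +
    Module.finrank k (LinearMap.range (d (p + 1) q)) ≤ Fintype.card (Cell (p + 1) (q + 1)) := by
  have h := ker_eq k d p (q + 1)
  have h2 : LinearMap.range (d (p + 1) q) ≤ LinearMap.ker (d p (q + 1)) := by
    rintro _ ⟨x, rfl⟩
    exact dd_zero k d hd p q x
  have h3 : Module.finrank k (LinearMap.range (d (p + 1) q)) ≤
      Module.finrank k (LinearMap.ker (d p (q + 1))) := Submodule.finrank_mono h2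
  omega

lemma r_eq (hd : IsKoszul k d) (p q : ℕ) :
    Module.finrank k (LinearMap.range (d p q)) = (Uset (p + 1) q).card := by
  have h1 := rank_lower k d hd p q
  by_cases hc : veroneseP2TwistBetti p (p + (q + 1)) = 0
  · have h2 := card_split p (q + 1)
    rw [Cset_card, hc, ← UL_card] at h2
    rcases p with _ | p
    · have h3 : Module.finrank k (LinearMap.range (d 0 q)) ≤ Fintype.card (Cell 0 (q + 1)) := by
        rw [← dim_eq k]
        exact Submodule.finrank_le _
      rw [U_zero] at h2
      omega
    · have h3 := rank_sum k d hd p q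
      have h4 := rank_lower k d hd p (q + 1)
      omega
  · have hc2 : p = 3 ∧ q = 0 := by
      unfold veroneseP2TwistBetti at hc
      split at hc <;> omega
    obtain ⟨rfl, rfl⟩ := hc2
    have h2 := card_split 4 0
    have h3 := ker_eq k d 3 0
    rw [Cset_card, L_zero] at h2
    simp only [veroneseP2TwistBetti] at h2
    simp only [Nat.reduceAdd] at h1 h2 h3 ⊢
    omega

end

end VerAux

theorem veronese_P2_twist_resolution (k : Type) [Field k] [CharZero k] [IsAlgClosed k]
    (d : ∀ p q : ℕ, koszulTerm k 3 (p + 1) (2 * q + 1) →ₗ[k] koszulTerm k 3 p (2 * q + 3))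
    (hd : ∀ (p q : ℕ) (v : Fin (p + 1) → homPart k 3 2) (f : homPart k 3 (2 * q + 1)),
      d p q (TensorProduct.tmul k (wedge k 3 (p + 1) v) f) =
        ∑ i : Fin (p + 1), ((-1 : k) ^ (i : ℕ)) •
          TensorProduct.tmul k (wedge k 3 p (fun j => v (i.succAbove j)))
            (mulQuad k 3 (v i) f)) :
    (∀ p q : ℕ, Module.finrank k (LinearMap.ker (d p (q + 1))) =
        Module.finrank k (LinearMap.range (d (p + 1) q)) +
          veroneseP2TwistBetti (p + 1) ((p + 1) + (q + 1))) ∧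
    (∀ p : ℕ, Module.finrank k (LinearMap.ker (d p 0)) =
        veroneseP2TwistBetti (p + 1) (p + 1)) ∧
    (∀ q : ℕ, Module.finrank k (koszulTerm k 3 0 (2 * (q + 1) + 1)) =
        Module.finrank k (LinearMap.range (d 0 q)) + veroneseP2TwistBetti 0 (q + 1)) ∧
    Module.finrank k (koszulTerm k 3 0 1) = veroneseP2TwistBetti 0 0 := by
  have hr := VerAux.r_eq k d hd
  have hk := VerAux.ker_eq k d
  refine ⟨fun p q => ?_, fun p => ?_, fun q => ?_, ?_⟩
  · have h1 := hr p (q + 1)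
    have h2 := hr (p + 1) q
    have h3 := hk p (q + 1)
    have h4 := VerAux.card_split (p + 1) (q + 1)
    have h5 := VerAux.UL_card (p + 1) q
    rw [VerAux.Cset_card] at h4
    omega
  · have h1 := hr p 0
    have h3 := hk p 0
    have h4 := VerAux.card_split (p + 1) 0
    have h5 := VerAux.L_zero (p + 1)
    rw [VerAux.Cset_card] at h4
    simp only [Nat.add_zero] at h4
    omega
  · have h2 := hr 0 q
    have h4 := VerAux.card_split 0 (q + 1)
    have h5 := VerAux.UL_card 0 q
    have h6 := VerAux.U_zero (q + 1)
    rw [VerAux.Cset_card, Nat.zero_add] at h4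
    rw [VerAux.dim_eq]
    omega
  · have h4 := VerAux.card_split 0 0
    rw [VerAux.Cset_card, VerAux.U_zero, VerAux.L_zero] at h4
    have := VerAux.dim_eq k 0 0
    simp only [Nat.mul_zero, Nat.zero_add] at this h4
    rw [this, h4]
end

section
/- Let G be a reductive group and λ a dominant weight that is not tensor-multiplicity-free (TMF), i.e., there exist dominant ν, θ with V_θ appearing with multiplicity ≥ 2 in V_λ ⊗ V_ν. Then for any dominant weight μ, the weight λ + μ is also not TMF: V_{θ+μ} appears with multiplicity ≥ 2 in V_{λ+μ} ⊗ V_ν. -/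
open CategoryTheory MonoidalCategory

set_option linter.unusedSectionVars false



namespace Chev
open Module

section basics
variable {k : Type} [Field k] {G : Type} [Group G]

instance Oacg (O : Subalgebra k (G → k)) : AddCommGroup O := (inferInstance : AddCommGroup O)
instance Oacm (O : Subalgebra k (G → k)) : AddCommMonoid O := AddCommGroup.toAddCommMonoid

/-- Stability of a function algebra under translations. -/
structure Stab (O : Subalgebra k (G → k)) : Prop where
  left : ∀ f ∈ O, ∀ g : G, (fun x => f (g * x)) ∈ O
  right : ∀ f ∈ O, ∀ g : G, (fun x => f (x * g)) ∈ O

variable {O : Subalgebra k (G → k)}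

/-- Left translation. -/
def Lop (hS : Stab O) (g : G) : Module.End k O where
  toFun f := ⟨fun x => f.1 (g * x), hS.left f.1 f.2 g⟩
  map_add' _ _ := rfl
  map_smul' _ _ := rfl

/-- Right translation. -/
def Rop (hS : Stab O) (g : G) : Module.End k O where
  toFun f := ⟨fun x => f.1 (x * g), hS.right f.1 f.2 g⟩
  map_add' _ _ := rfl
  map_smul' _ _ := rfl

@[simp] lemma Lop_apply (hS : Stab O) (g : G) (f : O) (x : G) :
    (Lop hS g f).1 x = f.1 (g * x) := rfl
@[simp] lemma Rop_apply (hS : Stab O) (g : G) (f : O) (x : G) :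
    (Rop hS g f).1 x = f.1 (x * g) := rfl

lemma Lop_mul (hS : Stab O) (g : G) (a b : O) :
    Lop hS g (a * b) = Lop hS g a * Lop hS g b := rfl
lemma Rop_mul (hS : Stab O) (g : G) (a b : O) :
    Rop hS g (a * b) = Rop hS g a * Rop hS g b := rfl

lemma Rop_Rop_inv (hS : Stab O) (g : G) (f : O) : Rop hS g (Rop hS g⁻¹ f) = f := by
  ext x; simp [Rop]
lemma Rop_inv_Rop (hS : Stab O) (g : G) (f : O) : Rop hS g⁻¹ (Rop hS g f) = f := by
  ext x; simp [Rop]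

/-- Left invariant endomorphisms. -/
def LInv (hS : Stab O) (D : Module.End k O) : Prop :=
  ∀ g f, D (Lop hS g f) = Lop hS g (D f)

lemma LInv.Rop (hS : Stab O) (g : G) : LInv hS (Rop hS g) := by
  intro h f; ext x; simp [Chev.Rop, Lop, mul_assoc]

lemma LInv.mul {hS : Stab O} {D E : Module.End k O} (hD : LInv hS D) (hE : LInv hS E) :
    LInv hS (D * E) := by
  intro h f; simp [hE h f, hD h]

/-- The Lie algebra of left invariant derivations. -/
def LieD (hS : Stab O) : Submodule k (Module.End k O) where
  carrier := {D | (∀ a b, D (a * b) = a * D b + b * D a) ∧ LInv hS D}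
  add_mem' := by
    rintro D E ⟨h1, h2⟩ ⟨h3, h4⟩
    refine ⟨fun a b => ?_, fun g f => ?_⟩
    · simp only [LinearMap.add_apply, h1, h3]; ring
    · simp only [LinearMap.add_apply, h2 g, h4 g, map_add]
  zero_mem' := by
    refine ⟨fun a b => ?_, fun g f => ?_⟩ <;> simp
  smul_mem' := by
    rintro c D ⟨h1, h2⟩
    refine ⟨fun a b => ?_, fun g f => ?_⟩
    · simp only [LinearMap.smul_apply, h1, smul_add, mul_smul_comm]
    · simp only [LinearMap.smul_apply, h2 g, map_smul]

lemma LieD.bracket {hS : Stab O} {D E : Module.End k O} (hD : D ∈ LieD hS) (hE : E ∈ LieD hS) :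
    D * E - E * D ∈ LieD hS := by
  refine ⟨fun a b => ?_, fun g f => ?_⟩
  · simp only [LinearMap.sub_apply, Module.End.mul_apply, hD.1, hE.1, map_add]; ring
  · simp only [LinearMap.sub_apply, Module.End.mul_apply, hD.2 g, hE.2 g, map_sub]

lemma LieD.conj {hS : Stab O} {D : Module.End k O} (hD : D ∈ LieD hS) (g : G) :
    Rop hS g * D * Rop hS g⁻¹ ∈ LieD hS := by
  refine ⟨fun a b => ?_, ((LInv.Rop hS g).mul hD.2).mul (LInv.Rop hS g⁻¹)⟩
  simp only [Module.End.mul_apply, Rop_mul, hD.1, map_add, Rop_Rop_inv]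

lemma LieD.one {hS : Stab O} {D : Module.End k O} (hD : D ∈ LieD hS) : D 1 = 0 := by
  have := hD.1 1 1
  simpa using this

variable {T : Type} [AddCommGroup T] [Module k T] [FiniteDimensional k T]

/-- All matrix coefficients lie in `O`. -/
def IsO (O : Subalgebra k (G → k)) {T : Type} [AddCommGroup T] [Module k T]
    (ρ : Representation k G T) : Prop :=
  ∀ (l : Dual k T) (t : T), (fun g => l (ρ g t)) ∈ O

/-- Matrix coefficient map. -/
def mc {T : Type} [AddCommGroup T] [Module k T] {ρ : Representation k G T} (h : IsO O ρ) :
    Dual k T →ₗ[k] T →ₗ[k] O :=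
  LinearMap.mk₂ k (fun l t => ⟨fun g => l (ρ g t), h l t⟩)
    (by intros; ext; simp) (by intros; ext; simp) (by intros; ext; simp) (by intros; ext; simp)

@[simp] lemma mc_apply {ρ : Representation k G T} (h : IsO O ρ) (l : Dual k T) (t : T) (g : G) :
    (mc h l t).1 g = l (ρ g t) := rfl

/-- Evaluation at a point. -/
def ev (O : Subalgebra k (G → k)) (g : G) : O →ₐ[k] k :=
  (Pi.evalAlgHom k (fun _ : G => k) g).comp O.val

@[simp] lemma ev_apply (g : G) (f : O) : ev O g f = f.1 g := rfl

/-- Action of `End O` on a representation with coefficients in `O`. -/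
noncomputable def Phi {ρ : Representation k G T} (h : IsO O ρ) :
    Module.End k O →ₗ[k] Module.End k T :=
  LinearMap.mk₂ k (fun D t => (evalEquiv k T).symm
      ((ev O 1).toLinearMap ∘ₗ D ∘ₗ (mc h).flip t))
    (by intros; rw [← map_add]; congr 1)
    (by intros; rw [← map_smul]; congr 1)
    (by intros; rw [← map_add]; congr 1; ext; simp)
    (by intros; rw [← map_smul]; congr 1; ext; simp)

lemma dual_Phi {ρ : Representation k G T} (h : IsO O ρ) (D : Module.End k O) (l : Dual k T) (t : T) :
    l (Phi h D t) = (D (mc h l t)).1 1 := by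
  simp only [Phi, LinearMap.mk₂_apply]
  rw [apply_evalEquiv_symm_apply]; rfl

lemma ext_dual {a b : T} (h : ∀ l : Dual k T, l a = l b) : a = b := by
  rw [← sub_eq_zero]
  apply (forall_dual_apply_eq_zero_iff k _).1
  intro l; simp [h l]

lemma mc_Phi {hS : Stab O} {ρ : Representation k G T} (h : IsO O ρ) {D : Module.End k O}
    (hD : LInv hS D) (l : Dual k T) (t : T) : mc h l (Phi h D t) = D (mc h l t) := by
  ext g
  have h1 : mc h (l ∘ₗ ρ g) t = Lop hS g (mc h l t) := by
    ext x; simp [Lop, mc]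
  have h2 := dual_Phi h D (l ∘ₗ ρ g) t
  rw [h1, hD g] at h2
  simpa using h2

lemma Phi_mul {hS : Stab O} {ρ : Representation k G T} (h : IsO O ρ) (D : Module.End k O)
    {E : Module.End k O} (hE : LInv hS E) : Phi h (D * E) = Phi h D * Phi h E := by
  ext t
  apply ext_dual (k := k)
  intro l
  rw [dual_Phi, Module.End.mul_apply, Module.End.mul_apply, dual_Phi, mc_Phi h hE]

lemma Phi_Rop (hS : Stab O) {ρ : Representation k G T} (h : IsO O ρ) (g : G) :
    Phi h (Rop hS g) = ρ g := by
  ext t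
  apply ext_dual (k := k)
  intro l
  rw [dual_Phi]; simp

lemma Phi_conj {hS : Stab O} {ρ : Representation k G T} (h : IsO O ρ) {D : Module.End k O}
    (hD : LInv hS D) (g : G) :
    Phi h (Rop hS g * D * Rop hS g⁻¹) = ρ g * Phi h D * ρ g⁻¹ := by
  rw [Phi_mul h _ (LInv.Rop hS _), Phi_mul h _ hD, Phi_Rop, Phi_Rop]

lemma Phi_bracket {hS : Stab O} {ρ : Representation k G T} (h : IsO O ρ) {D E : Module.End k O}
    (hD : LInv hS D) (hE : LInv hS E) :
    Phi h (D * E - E * D) = Phi h D * Phi h E - Phi h E * Phi h D := by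
  rw [← Phi_mul h _ hD, ← Phi_mul h _ hE]
  exact (Phi h).map_sub (D * E) (E * D)

variable {T' : Type} [AddCommGroup T'] [Module k T'] [FiniteDimensional k T']

lemma Phi_map {ρ : Representation k G T} (h : IsO O ρ) {ρ' : Representation k G T'}
    (h' : IsO O ρ') (f : T →ₗ[k] T') (hf : ∀ g t, f (ρ g t) = ρ' g (f t)) (D : Module.End k O)
    (t : T) : Phi h' D (f t) = f (Phi h D t) := by
  apply ext_dual (k := k)
  intro l
  rw [dual_Phi]
  have h2 := dual_Phi h D (l ∘ₗ f) t
  have h1 : mc h (l ∘ₗ f) t = mc h' l (f t) := by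
    ext x; simp [mc, hf]
  rw [h1] at h2
  exact h2.symm

lemma Phi_functional {hS : Stab O} {ρ : Representation k G T} (h : IsO O ρ) (p : Dual k T)
    (hp : ∀ g t, p (ρ g t) = p t) {D : Module.End k O} (hD : D ∈ LieD hS) (t : T) :
    p (Phi h D t) = 0 := by
  rw [dual_Phi]
  have : mc h p t = p t • 1 := by ext x; simp [mc, hp]
  rw [this, map_smul, LieD.one hD]; simp

/-- restriction of a representation to a stable subspace -/
def subRep (ρ : Representation k G T) (S : Submodule k T) (hs : ∀ g, ∀ t ∈ S, ρ g t ∈ S) :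
    Representation k G S where
  toFun g := (ρ g).restrict (hs g)
  map_one' := by ext; simp
  map_mul' _ _ := by ext; simp

@[simp] lemma subRep_coe (ρ : Representation k G T) (S : Submodule k T)
    (hs : ∀ g, ∀ t ∈ S, ρ g t ∈ S) (g : G) (s : S) : ((subRep ρ S hs g s : S) : T) = ρ g s := rfl

lemma subRep_isO {ρ : Representation k G T} (h : IsO O ρ) (S : Submodule k T)
    (hs : ∀ g, ∀ t ∈ S, ρ g t ∈ S) : IsO O (subRep ρ S hs) := by
  intro l t
  obtain ⟨l', hl'⟩ := LinearMap.exists_extend l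
  convert h l' t with g
  rw [← hl']; rfl

/-- quotient of a representation by a stable subspace -/
def quoRep (ρ : Representation k G T) (S : Submodule k T) (hs : ∀ g, ∀ t ∈ S, ρ g t ∈ S) :
    Representation k G (T ⧸ S) where
  toFun g := S.mapQ S (ρ g) (hs g)
  map_one' := by ext; simp
  map_mul' _ _ := by ext; simp

lemma quoRep_isO {ρ : Representation k G T} (h : IsO O ρ) (S : Submodule k T)
    (hs : ∀ g, ∀ t ∈ S, ρ g t ∈ S) : IsO O (quoRep ρ S hs) := by
  intro l t
  obtain ⟨t, rfl⟩ := S.mkQ_surjective t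
  exact h (l ∘ₗ S.mkQ) t

lemma Phi_stable {ρ : Representation k G T} (h : IsO O ρ) (S : Submodule k T)
    (hs : ∀ g, ∀ t ∈ S, ρ g t ∈ S) (D : Module.End k O) (t : T) (ht : t ∈ S) :
    Phi h D t ∈ S := by
  have := Phi_map (subRep_isO h S hs) h S.subtype (fun _ _ => rfl) D ⟨t, ht⟩
  rw [Submodule.subtype_apply] at this
  rw [this]; exact Subtype.coe_prop _

end basics
end Chev

namespace Chev
open Module

section replicas
variable {k : Type} [Field k] {G : Type} [Group G] {O : Subalgebra k (G → k)}

/-- `E` acts as `φ(λ)` on the generalized `λ`-eigenspaces of `D`. -/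
def IsReplica {M : Type} [AddCommGroup M] [Module k M] (φ : k → k) (D E : Module.End k M) : Prop :=
  ∀ (c : k) (m : M), m ∈ D.maxGenEigenspace c → E m = φ c • m

lemma gen_mul {D : Module.End k O} (hD : ∀ a b, D (a * b) = a * D b + b * D a) {c d : k} {a b : O}
    (ha : a ∈ D.maxGenEigenspace c) (hb : b ∈ D.maxGenEigenspace d) :
    a * b ∈ D.maxGenEigenspace (c + d) := by
  rw [Module.End.mem_maxGenEigenspace] at ha hb ⊢
  obtain ⟨m, hm⟩ := ha
  obtain ⟨n, hn⟩ := hb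
  refine ⟨m + n, ?_⟩
  have key : ∀ (a b : O), (D - (c + d) • (1 : Module.End k O)) (a * b)
      = ((D - c • (1 : Module.End k O)) a) * b + a * ((D - d • (1 : Module.End k O)) b) := by
    intro a b
    simp only [LinearMap.sub_apply, LinearMap.smul_apply, Module.End.one_apply, hD]
    simp only [sub_mul, mul_sub, smul_mul_assoc, mul_smul_comm, add_smul]
    ring
  have gen : ∀ (N m n : ℕ) (a b : O), m + n = N →
      ((D - c • (1 : Module.End k O)) ^ m) a = 0 → ((D - d • (1 : Module.End k O)) ^ n) b = 0 →
      ((D - (c + d) • (1 : Module.End k O)) ^ N) (a * b) = 0 := by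
    intro N
    induction N with
    | zero =>
      intro m n a b h ha hb
      obtain ⟨rfl, rfl⟩ : m = 0 ∧ n = 0 := by omega
      have : a = 0 := by simpa using ha
      simp [this]
    | succ N ih =>
      intro m n a b h ha hb
      rw [pow_succ, Module.End.mul_apply, key, map_add]
      rcases m with _ | m
      · have : a = 0 := by simpa using ha
        simp [this]
      rcases n with _ | n
      · have : b = 0 := by simpa using hb
        simp [this]
      rw [ih m (n + 1) _ _ (by omega) (by rw [pow_succ] at ha; exact ha) hb,
        ih (m + 1) n _ _ (by omega) ha (by rw [pow_succ] at hb; exact hb), add_zero]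
  exact gen _ m n a b rfl hm hn

lemma exists_replica_aux {M : Type} [AddCommGroup M] [Module k M] (D : Module.End k M)
    (htop : ⨆ c, D.maxGenEigenspace c = ⊤) (φ : k → k) :
    ∃ E : Module.End k M, IsReplica φ D E := by
  classical
  have hI : DirectSum.IsInternal (fun c => D.maxGenEigenspace c) :=
    DirectSum.isInternal_submodule_of_iSupIndep_of_iSup_eq_top D.independent_maxGenEigenspace htop
  let e := LinearEquiv.ofBijective (DirectSum.coeLinearMap (fun c => D.maxGenEigenspace c)) hI
  refine ⟨(DirectSum.toModule k k M (fun c => φ c • (D.maxGenEigenspace c).subtype)) ∘ₗ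
    e.symm.toLinearMap, fun c m hm => ?_⟩
  have : e.symm m = DirectSum.lof k k (fun c => D.maxGenEigenspace c) c ⟨m, hm⟩ := by
    rw [LinearEquiv.symm_apply_eq]
    exact (DirectSum.coeLinearMap_lof (fun c => D.maxGenEigenspace c) c ⟨m, hm⟩).symm
  simp [this]

lemma exists_replica {hS : Stab O} {D : Module.End k O} (hD : D ∈ LieD hS)
    (htop : ⨆ c, D.maxGenEigenspace c = ⊤) (φ : k →+ k) :
    ∃ E ∈ LieD hS, IsReplica φ D E := by
  obtain ⟨E, hE⟩ := exists_replica_aux D htop φ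
  refine ⟨E, ⟨fun a b => ?_, fun g f => ?_⟩, hE⟩
  · have ha : a ∈ ⨆ c, D.maxGenEigenspace c := htop ▸ Submodule.mem_top
    have hb : b ∈ ⨆ c, D.maxGenEigenspace c := htop ▸ Submodule.mem_top
    induction ha using Submodule.iSup_induction' with
    | zero => simp
    | add x y _ _ hx hy => simp only [add_mul, map_add, hx, hy, mul_add]; ring
    | mem c a ha =>
      induction hb using Submodule.iSup_induction' with
      | zero => simp
      | add x y _ _ hx hy => simp only [add_mul, map_add, hx, hy, mul_add]; ring
      | mem d b hb =>
        rw [hE _ _ ha, hE _ _ hb, hE _ _ (gen_mul hD.1 ha hb), map_add, add_smul]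
        simp only [mul_smul_comm]
        rw [add_comm, mul_comm b a]
  · have ha : f ∈ ⨆ c, D.maxGenEigenspace c := htop ▸ Submodule.mem_top
    induction ha using Submodule.iSup_induction' with
    | zero => simp
    | add x y _ _ hx hy => simp only [map_add, hx, hy]
    | mem c f hf =>
      rw [hE _ _ hf, map_smul]
      apply hE
      exact Module.End.mapsTo_maxGenEigenspace_of_comm
        (show Commute D (Lop hS g) from LinearMap.ext fun f => hD.2 g f) c hf

variable {T : Type} [AddCommGroup T] [Module k T] [FiniteDimensional k T]

lemma mc_gen {hS : Stab O} {ρ : Representation k G T} (h : IsO O ρ) {D : Module.End k O}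
    (hD : LInv hS D) (l : Dual k T) (c : k) (t : T) (ht : t ∈ (Phi h D).maxGenEigenspace c) :
    mc h l t ∈ D.maxGenEigenspace c := by
  rw [Module.End.mem_maxGenEigenspace] at ht ⊢
  obtain ⟨m, hm⟩ := ht
  refine ⟨m, ?_⟩
  have : ∀ (m : ℕ) (t : T), ((D - c • (1 : Module.End k O)) ^ m) (mc h l t)
      = mc h l (((Phi h D - c • (1 : Module.End k T)) ^ m) t) := by
    intro m
    induction m with
    | zero => intro t; simp
    | succ m ih =>
      intro t
      rw [pow_succ, pow_succ, Module.End.mul_apply, Module.End.mul_apply, ← ih]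
      congr 1
      simp [mc_Phi h hD]
  rw [this, hm, map_zero]

lemma Phi_replica {hS : Stab O} {ρ : Representation k G T} (h : IsO O ρ) {D E : Module.End k O}
    (hD : LInv hS D) (φ : k → k) (hE : IsReplica φ D E) :
    IsReplica φ (Phi h D) (Phi h E) := by
  intro c t ht
  apply ext_dual (k := k)
  intro l
  rw [dual_Phi, hE c _ (mc_gen h hD l c t ht)]
  simp

end replicas

section trace
variable {k : Type} [Field k] [IsAlgClosed k] [CharZero k]
variable {T : Type} [AddCommGroup T] [Module k T] [FiniteDimensional k T]

lemma trace_replica (φ : k → k) (D E : Module.End k T) (hE : IsReplica φ D E) :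
    ∃ s : Finset k, (∀ c, D.HasEigenvalue c → c ∈ s) ∧ LinearMap.trace k T (D * E) =
      ∑ c ∈ s, (finrank k (D.maxGenEigenspace c) : k) * (c * φ c) := by
  classical
  have htop : ⨆ c, D.maxGenEigenspace c = ⊤ := Module.End.iSup_maxGenEigenspace_eq_top D
  have hI : DirectSum.IsInternal (fun c => D.maxGenEigenspace c) :=
    DirectSum.isInternal_submodule_of_iSupIndep_of_iSup_eq_top D.independent_maxGenEigenspace htop
  have hfin : {c | D.maxGenEigenspace c ≠ ⊥}.Finite :=
    WellFoundedGT.finite_ne_bot_of_iSupIndep D.independent_maxGenEigenspace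
  have hmD : ∀ c, Set.MapsTo D (D.maxGenEigenspace c) (D.maxGenEigenspace c) := fun c =>
    Module.End.mapsTo_maxGenEigenspace_of_comm (Commute.refl D) c
  have hm : ∀ c, Set.MapsTo (D * E) (D.maxGenEigenspace c) (D.maxGenEigenspace c) := by
    intro c m hm
    change D (E m) ∈ _
    rw [hE c m hm, map_smul]
    exact Submodule.smul_mem _ _ (hmD c hm)
  refine ⟨hfin.toFinset, ?_, ?_⟩
  · intro c hc
    simp only [Set.Finite.mem_toFinset, Set.mem_ofPred_eq]
    intro h0
    exact hc (eq_bot_iff.2 (h0 ▸ (D.genEigenspace c).monotone le_top))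
  · rw [LinearMap.trace_eq_sum_trace_restrict' hI hfin hm]
    refine Finset.sum_congr rfl fun c _ => ?_
    have h1 : (D * E).restrict (hm c) = φ c • (D.restrict (hmD c)) := by
      ext ⟨m, hm⟩
      change D (E m) = φ c • D m
      rw [hE c m hm, map_smul]
    have hn : IsNilpotent ((D - algebraMap k _ c).restrict
        (Module.End.mapsTo_maxGenEigenspace_of_comm (Algebra.mul_sub_algebraMap_commutes D c) c)) :=
      Module.End.isNilpotent_restrict_maxGenEigenspace_sub_algebraMap D c
    have h2 : D.restrict (hmD c) = c • (1 : Module.End k _) + ((D - algebraMap k _ c).restrict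
        (Module.End.mapsTo_maxGenEigenspace_of_comm (Algebra.mul_sub_algebraMap_commutes D c) c)) := by
      ext ⟨m, hm⟩
      change D m = c • m + (D m - c • m)
      simp
    rw [h1, map_smul, h2, map_add, map_smul,
      (LinearMap.isNilpotent_trace_of_isNilpotent hn).eq_zero]
    simp
    ring

lemma nilp_of_trace {ι : Type} [Fintype ι] {X : ι → Type} [∀ i, AddCommGroup (X i)]
    [∀ i, Module k (X i)] [∀ i, FiniteDimensional k (X i)] (D : ∀ i, Module.End k (X i))
    (H : ∀ φ : k →+ k, ∃ E : ∀ i, Module.End k (X i), (∀ i, IsReplica φ (D i) (E i)) ∧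
      ∑ i, LinearMap.trace k (X i) (D i * E i) = 0) (i : ι) : IsNilpotent (D i) := by
  have hz : ∀ c, (D i).HasEigenvalue c → c = 0 := by
    intro c hc
    by_contra h0
    obtain ⟨ψ, hψ⟩ : ∃ ψ : Dual ℚ k, ψ c ≠ 0 := by
      by_contra! hcon
      exact h0 ((forall_dual_apply_eq_zero_iff ℚ c).1 hcon)
    let φ : k →+ k := (algebraMap ℚ k).toAddMonoidHom.comp ψ.toAddMonoidHom
    obtain ⟨E, hE, hs⟩ := H φ
    choose s hs1 hs2 using fun i => trace_replica φ (D i) (E i) (hE i)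
    have h1 : ∑ i, ∑ c ∈ s i, (finrank k ((D i).maxGenEigenspace c) : ℚ) * (ψ c * ψ c) = 0 := by
      have := congrArg ψ hs
      rw [map_zero, map_sum] at this
      rw [← this]
      refine Finset.sum_congr rfl fun j _ => ?_
      rw [hs2, map_sum]
      refine Finset.sum_congr rfl fun c _ => ?_
      have : ((finrank k ((D j).maxGenEigenspace c) : k) * (c * φ c)) =
          ((finrank k ((D j).maxGenEigenspace c) : ℚ) * ψ c) • c := by
        rw [Algebra.smul_def]
        simp [φ]; ring
      rw [this, map_smul, smul_eq_mul]; ring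
    rw [Finset.sum_eq_zero_iff_of_nonneg (fun j _ => Finset.sum_nonneg fun c _ =>
      mul_nonneg (Nat.cast_nonneg _) (mul_self_nonneg _))] at h1
    have h2 := h1 i (Finset.mem_univ i)
    rw [Finset.sum_eq_zero_iff_of_nonneg (fun c _ =>
      mul_nonneg (Nat.cast_nonneg _) (mul_self_nonneg _))] at h2
    have h3 := h2 c (hs1 i c hc)
    rcases mul_eq_zero.1 h3 with h | h
    · have : finrank k ((D i).maxGenEigenspace c) = 0 := by exact_mod_cast h
      rw [Submodule.finrank_eq_zero] at this
      exact hc (eq_bot_iff.2 (this ▸ ((D i).genEigenspace c).monotone le_top))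
    · exact hψ (mul_self_eq_zero.1 h)
  have htop := Module.End.iSup_maxGenEigenspace_eq_top (D i)
  have h0 : (D i).maxGenEigenspace 0 = ⊤ := by
    rw [← htop]
    apply le_antisymm (le_iSup (fun c => (D i).maxGenEigenspace c) 0)
    apply iSup_le
    intro c
    by_cases hc : (D i).HasEigenvalue c
    · rw [hz c hc]
    · have : (D i).maxGenEigenspace c = ⊥ := by
        by_contra hcon
        exact hc (Module.End.HasUnifEigenvalue.lt zero_lt_one hcon)
      rw [this]; exact bot_le
  have := Module.End.isNilpotent_restrict_maxGenEigenspace_sub_algebraMap (D i) 0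
  rw [Module.End.maxGenEigenspace_eq_genEigenspace_finrank] at h0
  refine ⟨finrank k (X i), ?_⟩
  ext x
  have hx : x ∈ (D i).genEigenspace 0 (finrank k (X i)) := h0 ▸ Submodule.mem_top
  rw [Module.End.mem_genEigenspace_nat] at hx
  simpa using hx

end trace
end Chev

namespace Chev
open Module

section engel
attribute [local instance] LieRing.ofAssociativeRing

lemma engel {k : Type} [Field k] {X : Type} [AddCommGroup X] [Module k X] [FiniteDimensional k X]
    [Nontrivial X] (n : Submodule k (Module.End k X))
    (hb : ∀ a ∈ n, ∀ b ∈ n, a * b - b * a ∈ n) (hn : ∀ a ∈ n, IsNilpotent a) :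
    ∃ x : X, x ≠ 0 ∧ ∀ a ∈ n, a x = 0 := by
  let K : LieSubalgebra k (Module.End k X) := { n with lie_mem' := fun {a b} ha hb' => hb a ha b hb' }
  have hN : LieModule.IsNilpotent K X := by
    rw [LieModule.isNilpotent_iff_forall' (R := k)]
    rintro ⟨a, ha⟩
    exact hn a ha
  have hne := LieModule.nontrivial_max_triv_of_isNilpotent k K X
  obtain ⟨⟨x, hx⟩, hx0⟩ := exists_ne (0 : LieModule.maxTrivSubmodule k K X)
  rw [LieModule.mem_maxTrivSubmodule] at hx
  refine ⟨x, fun h => hx0 (by ext; exact h), fun a ha => hx ⟨a, ha⟩⟩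

end engel

section forms
variable {k : Type} [Field k] {G : Type} [Group G] {O : Subalgebra k (G → k)}

/-- irreducible representation, in terms of subspaces -/
structure Irr {T : Type} [AddCommGroup T] [Module k T] (ρ : Representation k G T) : Prop where
  nontriv : Nontrivial T
  eq : ∀ S : Submodule k T, (∀ g, ∀ t ∈ S, ρ g t ∈ S) → S = ⊥ ∨ S = ⊤

/-- conjugation on endomorphisms -/
def Ad (hS : Stab O) (g : G) : Module.End k O →ₗ[k] Module.End k O where
  toFun D := Rop hS g * D * Rop hS g⁻¹
  map_add' _ _ := by ext; simp
  map_smul' _ _ := by ext; simp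

/-- ideals stable under all operations -/
structure Good (hS : Stab O) (J : Submodule k (Module.End k O)) : Prop where
  le : J ≤ LieD hS
  conj : ∀ g, ∀ D ∈ J, Ad hS g D ∈ J
  bracket : ∀ D ∈ J, ∀ E ∈ J, D * E - E * D ∈ J
  replica : ∀ D ∈ J, ∀ φ : k →+ k, ∃ E ∈ J, IsReplica φ D E

variable {ι : Type} [Fintype ι] {X : ι → Type} [∀ i, AddCommGroup (X i)]
    [∀ i, Module k (X i)] [∀ i, FiniteDimensional k (X i)] {ρ : ∀ i, Representation k G (X i)}

/-- sum of trace forms -/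
noncomputable def BF (h : ∀ i, IsO O (ρ i)) : LinearMap.BilinForm k (Module.End k O) :=
  LinearMap.mk₂ k (fun D E => ∑ i, LinearMap.trace k (X i) (Phi (h i) D * Phi (h i) E))
    (by intros; simp [add_mul, Finset.sum_add_distrib])
    (by intros; simp [Finset.mul_sum])
    (by intros; simp [mul_add, Finset.sum_add_distrib])
    (by intros; simp [Finset.mul_sum])

lemma BF_apply (h : ∀ i, IsO O (ρ i)) (D E : Module.End k O) :
    BF h D E = ∑ i, LinearMap.trace k (X i) (Phi (h i) D * Phi (h i) E) := rfl

lemma BF_symm (h : ∀ i, IsO O (ρ i)) (D E : Module.End k O) : BF h D E = BF h E D := by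
  simp only [BF_apply]
  exact Finset.sum_congr rfl fun i _ => LinearMap.trace_mul_comm _ _ _

lemma BF_conj {hS : Stab O} (h : ∀ i, IsO O (ρ i)) {D E : Module.End k O} (hD : LInv hS D)
    (hE : LInv hS E) (g : G) : BF h (Ad hS g D) (Ad hS g E) = BF h D E := by
  simp only [BF_apply]
  refine Finset.sum_congr rfl fun i _ => ?_
  change LinearMap.trace k (X i) (Phi (h i) (Rop hS g * D * Rop hS g⁻¹) *
    Phi (h i) (Rop hS g * E * Rop hS g⁻¹)) = _
  rw [Phi_conj (h i) hD, Phi_conj (h i) hE]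
  have h1 : ρ i g⁻¹ * ρ i g = 1 := by rw [← map_mul]; simp
  have : ρ i g * Phi (h i) D * ρ i g⁻¹ * (ρ i g * Phi (h i) E * ρ i g⁻¹) =
      ρ i g * (Phi (h i) D * (ρ i g⁻¹ * ρ i g) * Phi (h i) E * ρ i g⁻¹) := by
    simp only [mul_assoc]
  rw [this, LinearMap.trace_mul_comm, h1, mul_one, mul_assoc, h1, mul_one]

lemma BF_bracket {hS : Stab O} (h : ∀ i, IsO O (ρ i)) {D E F : Module.End k O} (hD : LInv hS D)
    (hE : LInv hS E) (hF : LInv hS F) : BF h (D * E - E * D) F = BF h D (E * F - F * E) := by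
  simp only [BF_apply]
  refine Finset.sum_congr rfl fun i _ => ?_
  rw [Phi_bracket (h i) hD hE, Phi_bracket (h i) hE hF, sub_mul, mul_sub]
  have := LinearMap.trace_mul_comm k (Phi (h i) E) (Phi (h i) D * Phi (h i) F)
  rw [← mul_assoc, mul_assoc] at this
  rw [LinearMap.map_sub, LinearMap.map_sub, mul_assoc, mul_assoc, this, mul_assoc]

variable [IsAlgClosed k] [CharZero k]

lemma kills {hS : Stab O} (h : ∀ i, IsO O (ρ i)) (hirr : ∀ i, Irr (ρ i))
    {J : Submodule k (Module.End k O)} (hJ : Good hS J) {D : Module.End k O} (hD : D ∈ J)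
    (h0 : ∀ E ∈ J, BF h D E = 0) (i : ι) : Phi (h i) D = 0 := by
  have hnil : ∀ D ∈ J, (∀ E ∈ J, BF h D E = 0) → ∀ i, IsNilpotent (Phi (h i) D) := by
    intro D hD h0 i
    apply nilp_of_trace (fun i => Phi (h i) D)
    intro φ
    obtain ⟨E, hE, hEr⟩ := hJ.replica D hD φ
    exact ⟨fun i => Phi (h i) E, fun i => Phi_replica (h i) (hJ.le hD).2 φ hEr, h0 E hE⟩
  let n : Submodule k (Module.End k O) :=
    { carrier := {D | D ∈ J ∧ ∀ E ∈ J, BF h D E = 0}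
      add_mem' := by
        rintro a b ⟨h1, h2⟩ ⟨h3, h4⟩
        exact ⟨J.add_mem h1 h3, fun E hE => by simp [h2 E hE, h4 E hE]⟩
      zero_mem' := ⟨J.zero_mem, fun E hE => by simp⟩
      smul_mem' := by
        rintro c a ⟨h1, h2⟩
        exact ⟨J.smul_mem c h1, fun E hE => by simp [h2 E hE]⟩ }
  have := (hirr i).nontriv
  obtain ⟨x, hx0, hx⟩ := engel (n.map (Phi (h i)))
    (by
      rintro _ ⟨a, ha, rfl⟩ _ ⟨b, hb, rfl⟩
      refine ⟨a * b - b * a, ⟨hJ.bracket a ha.1 b hb.1, fun E hE => ?_⟩, ?_⟩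
      · rw [BF_bracket h (hJ.le ha.1).2 (hJ.le hb.1).2 (hJ.le hE).2]
        exact ha.2 _ (hJ.bracket b hb.1 E hE)
      · rw [Phi_bracket (h i) (hJ.le ha.1).2 (hJ.le hb.1).2])
    (by
      rintro _ ⟨a, ha, rfl⟩
      exact hnil a ha.1 ha.2 i)
  let S : Submodule k (X i) :=
    { carrier := {x | ∀ a ∈ n, Phi (h i) a x = 0}
      add_mem' := by
        intro x y hx hy a ha
        rw [map_add, hx a ha, hy a ha, add_zero]
      zero_mem' := by intro a _; simp
      smul_mem' := by
        intro c x hx a ha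
        rw [map_smul, hx a ha, smul_zero] }
  have hSst : ∀ g, ∀ t ∈ S, ρ i g t ∈ S := by
    intro g t ht a ha
    have h1 : Ad hS g⁻¹ a ∈ n := by
      refine ⟨hJ.conj _ _ ha.1, fun E hE => ?_⟩
      have := BF_conj h (hJ.le (hJ.conj g⁻¹ a ha.1)).2 (hJ.le hE).2 g
      rw [← this]
      have h2 : Ad hS g (Ad hS g⁻¹ a) = a := by
        ext1 f
        simp [Ad, Rop_Rop_inv]
      rw [h2]
      exact ha.2 _ (hJ.conj g E hE)
    have h2 := ht _ h1
    change Phi (h i) (Rop hS g⁻¹ * a * Rop hS g⁻¹⁻¹) t = 0 at h2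
    rw [Phi_conj (h i) (hJ.le ha.1).2] at h2
    have h3 := congrArg (ρ i g) h2
    simpa using h3
  rcases (hirr i).eq S hSst with hb | ht
  · exfalso
    have : x ∈ S := fun a ha => hx _ ⟨a, ha, rfl⟩
    rw [hb] at this
    exact hx0 (by simpa using this)
  · ext x
    have : x ∈ S := ht ▸ Submodule.mem_top
    exact this D ⟨hD, h0⟩

end forms

section casimir
variable {k : Type} [Field k]

lemma casimir_inv {A : Type} [AddCommGroup A] [Module k A]
    [FiniteDimensional k A] (B : LinearMap.BilinForm k A) (hB : B.Nondegenerate)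
    {ι : Type} [Fintype ι] [DecidableEq ι] (b : Basis ι k A)
    {R : Type} [AddCommGroup R] [Module k R] (m : A →ₗ[k] A →ₗ[k] R)
    (u : A →ₗ[k] A) (v : A →ₗ[k] A) (hvu : ∀ x, u (v x) = x)
    (hu : ∀ x y, B (u x) y = B x (v y)) (hs : ∀ x y, B x y = B y x) :
    ∑ i, m (u (b i)) (u (B.dualBasis hB b i)) = ∑ i, m (b i) (B.dualBasis hB b i) := by
  have e1 : ∀ x, x = ∑ j, B x (B.dualBasis hB b j) • b j := by
    intro x
    conv_lhs => rw [← b.sum_repr x]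
    refine Finset.sum_congr rfl fun j _ => ?_
    congr 1
    rw [hs]
    conv_rhs => rw [← b.sum_repr x]
    simp only [map_sum, map_smul, LinearMap.BilinForm.apply_dualBasis_left]
    simp
  have e2 : ∀ x, x = ∑ j, B (b j) x • B.dualBasis hB b j := by
    intro x
    conv_lhs => rw [← (B.dualBasis hB b).sum_repr x]
    refine Finset.sum_congr rfl fun j _ => ?_
    congr 1
    rw [LinearMap.BilinForm.dualBasis_repr_apply, hs]
  calc ∑ i, m (u (b i)) (u (B.dualBasis hB b i))
      = ∑ i, ∑ j, B (u (b i)) (B.dualBasis hB b j) • m (b j) (u (B.dualBasis hB b i)) := by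
        refine Finset.sum_congr rfl fun i _ => ?_
        conv_lhs => rw [e1 (u (b i))]
        simp
    _ = ∑ j, m (b j) (u (∑ i, B (b i) (v (B.dualBasis hB b j)) • B.dualBasis hB b i)) := by
        rw [Finset.sum_comm]
        refine Finset.sum_congr rfl fun j _ => ?_
        simp [hu]
    _ = _ := by
        refine Finset.sum_congr rfl fun j _ => ?_
        rw [← e2, hvu]

end casimir
end Chev

namespace Chev
open Module

section step
variable {k : Type} [Field k] 

lemma replica_nilp {M : Type} [AddCommGroup M] [Module k M] {φ : k →+ k} {D E : Module.End k M}
    (h : IsReplica φ D E) (hD : IsNilpotent D) : E = 0 := by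
  obtain ⟨n, hn⟩ := hD
  ext m
  rw [h 0 m]
  · simp
  · rw [Module.End.mem_maxGenEigenspace]
    exact ⟨n, by simp [hn]⟩

lemma nondeg_restrict {M : Type} [AddCommGroup M] [Module k M] (B : LinearMap.BilinForm k M)
    (hs : ∀ x y, B x y = B y x) (J : Submodule k M)
    (hn : ∀ x ∈ J, (∀ y ∈ J, B x y = 0) → x = 0) : (B.restrict J).Nondegenerate := by
  refine ⟨fun x hx => ?_, fun x hx => ?_⟩
  · ext; exact hn x x.2 fun y hy => hx ⟨y, hy⟩
  · ext; exact hn x x.2 fun y hy => (hs _ _).trans (hx ⟨y, hy⟩)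

lemma repr_fun {M : Type} [AddCommGroup M] [Module k M] (B : LinearMap.BilinForm k M)
    (hs : ∀ x y, B x y = B y x) (J : Submodule k M) [FiniteDimensional k J]
    (hn : ∀ x ∈ J, (∀ y ∈ J, B x y = 0) → x = 0) (β : Dual k M) :
    ∃ x ∈ J, ∀ y ∈ J, B x y = β y := by
  have hnd := nondeg_restrict B hs J hn
  obtain ⟨x, hx⟩ := ((B.restrict J).toDual hnd).surjective (β ∘ₗ J.subtype)
  refine ⟨x, x.2, fun y hy => ?_⟩
  have := congrArg (fun f => f ⟨y, hy⟩) hx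
  simpa [LinearMap.BilinForm.toDual_def] using this

lemma casimir_exists {M : Type} [AddCommGroup M] [Module k M] (B : LinearMap.BilinForm k M)
    (hs : ∀ x y, B x y = B y x) (J : Submodule k M) [FiniteDimensional k J]
    (hn : ∀ x ∈ J, (∀ y ∈ J, B x y = 0) → x = 0) :
    ∃ (n : ℕ) (x y : Fin n → M), (∀ i, x i ∈ J) ∧ (∀ i, y i ∈ J) ∧ (∀ i, B (x i) (y i) = 1) ∧
      (n = 0 → J = ⊥) ∧ ∀ (Z : Type) [AddCommGroup Z] [Module k Z] (m : M →ₗ[k] M →ₗ[k] Z)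
        (u v : M →ₗ[k] M), (∀ x ∈ J, u x ∈ J) → (∀ x ∈ J, v x ∈ J) → (∀ x ∈ J, u (v x) = x) →
        (∀ x ∈ J, ∀ y ∈ J, B (u x) y = B x (v y)) →
        ∑ i, m (u (x i)) (u (y i)) = ∑ i, m (x i) (y i) := by
  classical
  have hnd := nondeg_restrict B hs J hn
  let b := Module.finBasis k J
  let b' := (B.restrict J).dualBasis hnd b
  refine ⟨_, fun i => b i, fun i => b' i, fun i => (b i).2, fun i => (b' i).2, fun i => ?_,
    fun h0 => Submodule.finrank_eq_zero.1 h0, fun Z _ _ m u v hu hv huv hadj => ?_⟩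
  · rw [hs]
    have := LinearMap.BilinForm.apply_dualBasis_left (B := B.restrict J) hnd b i i
    simpa using this
  · exact casimir_inv (B.restrict J) hnd b (m.compl₁₂ J.subtype J.subtype) (u.restrict hu)
      (v.restrict hv) (fun x => Subtype.ext (huv x x.2))
      (fun x y => hadj x x.2 y y.2) (fun x y => hs x y)

lemma fd_of_inj {M Z : Type} [AddCommGroup M] [Module k M] [AddCommGroup Z] [Module k Z]
    [FiniteDimensional k Z] (J : Submodule k M) (f : M →ₗ[k] Z) (h : ∀ x ∈ J, f x = 0 → x = 0) :
    FiniteDimensional k J := by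
  apply FiniteDimensional.of_injective (f ∘ₗ J.subtype)
  rw [injective_iff_map_eq_zero]
  rintro ⟨D, hD⟩ h'
  ext1
  exact h D hD h'

lemma fd_of_le {M : Type} [AddCommGroup M] [Module k M]
    {I J : Submodule k M} [FiniteDimensional k J] (h : I ≤ J) :
    FiniteDimensional k I := Submodule.finiteDimensional_of_le h

variable [IsAlgClosed k] [CharZero k] {G : Type} [Group G] {O : Subalgebra k (G → k)}
variable {ι : Type} [Fintype ι] {X : ι → Type} [∀ i, AddCommGroup (X i)]
    [∀ i, Module k (X i)] [∀ i, FiniteDimensional k (X i)] {ρX : ∀ i, Representation k G (X i)}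
variable {T : Type} [AddCommGroup T] [Module k T] [FiniteDimensional k T]

/-- Standing hypotheses on `O`: it is controlled by the irreducible representations `X i`. -/
structure Setup (hS : Stab O) (hX : ∀ i, IsO O (ρX i)) : Prop where
  irr : ∀ i, Irr (ρX i)
  good : Good hS (LieD hS)
  faithful : ∀ D ∈ LieD hS, (∀ i, Phi (hX i) D = 0) → D = 0

lemma Setup.fd {hS : Stab O} {hX : ∀ i, IsO O (ρX i)} (H : Setup hS hX) :
    FiniteDimensional k (LieD hS) := by
  apply fd_of_inj (LieD hS) (LinearMap.pi fun i => Phi (hX i))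
  intro D hD h
  exact H.faithful D hD fun i => congrFun h i

lemma Setup.nondeg {hS : Stab O} {hX : ∀ i, IsO O (ρX i)} (H : Setup hS hX)
    {J : Submodule k (Module.End k O)} (hJ : Good hS J) :
    ∀ x ∈ J, (∀ y ∈ J, BF hX x y = 0) → x = 0 := by
  intro x hx h
  exact H.faithful x (hJ.le hx) fun i => kills hX H.irr hJ hx h i

lemma unip_trivial {hS : Stab O} {hX : ∀ i, IsO O (ρX i)} (H : Setup hS hX)
    {ρ : Representation k G T} (h : IsO O ρ)
    (h2 : ∀ D ∈ LieD hS, ∀ E ∈ LieD hS, Phi h D * Phi h E = 0) :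
    ∀ D ∈ LieD hS, Phi h D = 0 := by
  have := H.fd
  intro x hx
  ext t
  apply ext_dual (k := k)
  intro l
  let β : Dual k (Module.End k O) := l ∘ₗ (LinearMap.applyₗ t) ∘ₗ Phi h
  have hβ : ∀ D, β D = l (Phi h D t) := fun D => rfl
  obtain ⟨y, hy, hyβ⟩ := repr_fun (BF hX) (BF_symm hX) (LieD hS) (H.nondeg H.good) β
  have hcomm : ∀ z ∈ LieD hS, y * z - z * y = 0 := by
    intro z hz
    apply H.nondeg H.good _ (LieD.bracket hy hz)
    intro w hw
    rw [BF_bracket hX hy.2 hz.2 hw.2, hyβ _ (LieD.bracket hz hw), hβ, Phi_bracket h hz.2 hw.2,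
      h2 _ hz _ hw, h2 _ hw _ hz]
    simp
  have hynil : ∀ i, IsNilpotent (Phi (hX i) y) := by
    apply nilp_of_trace (fun i => Phi (hX i) y)
    intro φ
    obtain ⟨E, hE, hEr⟩ := H.good.replica y hy φ
    refine ⟨fun i => Phi (hX i) E, fun i => Phi_replica (hX i) hy.2 φ hEr, ?_⟩
    have h3 : Phi h E = 0 := by
      apply replica_nilp (Phi_replica h hy.2 φ hEr)
      exact ⟨2, by rw [pow_two]; exact h2 _ hy _ hy⟩
    have := hyβ E hE
    rw [hβ, h3, BF_apply] at this
    simpa using this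
  rw [← hβ, ← hyβ x hx, BF_apply]
  simp only [LinearMap.zero_apply, map_zero]
  apply Finset.sum_eq_zero
  intro i _
  have hc : Commute (Phi (hX i) y) (Phi (hX i) x) := by
    have h3 := Phi_bracket (hX i) hy.2 hx.2
    rw [hcomm x hx, map_zero] at h3
    exact (sub_eq_zero.1 h3.symm)
  exact (LinearMap.isNilpotent_trace_of_isNilpotent (hc.isNilpotent_mul_right (hynil i))).eq_zero

lemma Ad_Ad_inv (hS : Stab O) (g : G) (a : Module.End k O) : Ad hS g (Ad hS g⁻¹ a) = a := by
  ext1 f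
  simp [Ad, Rop_Rop_inv]

lemma Phi_Ad {hS : Stab O} {ρ : Representation k G T} (h : IsO O ρ) {D : Module.End k O}
    (hD : LInv hS D) (g : G) :
    Phi h (Ad hS g D) = ρ g * Phi h D * ρ g⁻¹ := Phi_conj h hD g

lemma exists_casimir {hS : Stab O} {hX : ∀ i, IsO O (ρX i)} (H : Setup hS hX)
    {ρ : Representation k G T} (h : IsO O ρ) (N : Submodule k T)
    (hN : ∀ g, ∀ t ∈ N, ρ g t ∈ N) (hirr : Irr (subRep ρ N hN))
    (hTN : ∀ D ∈ LieD hS, ∀ t, Phi h D t ∈ N)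
    (hne : ∃ D ∈ LieD hS, Phi (subRep_isO h N hN) D ≠ 0) :
    ∃ c : Module.End k T, (∀ g, ρ g * c = c * ρ g) ∧ ∃ hc : ∀ t, c t ∈ N,
      LinearMap.trace k N (c.restrict (fun t _ => hc t)) ≠ 0 := by
  classical
  have := H.fd
  set hNO := subRep_isO h N hN with hNOdef
  let r : Submodule k (Module.End k O) := LieD hS ⊓ LinearMap.ker (Phi hNO)
  have hr : Good hS r := by
    refine ⟨inf_le_left, ?_, ?_, ?_⟩
    · rintro g D ⟨hD, hD0⟩
      refine ⟨H.good.conj g D hD, ?_⟩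
      replace hD0 : Phi hNO D = 0 := hD0
      change Phi hNO _ = 0
      rw [Phi_Ad hNO hD.2, hD0]; simp
    · rintro D ⟨hD, hD0⟩ E ⟨hE, hE0⟩
      refine ⟨LieD.bracket hD hE, ?_⟩
      replace hD0 : Phi hNO D = 0 := hD0
      replace hE0 : Phi hNO E = 0 := hE0
      change Phi hNO _ = 0
      rw [Phi_bracket hNO hD.2 hE.2, hD0, hE0]; simp
    · rintro D ⟨hD, hD0⟩ φ
      obtain ⟨E, hE, hEr⟩ := H.good.replica D hD φ
      refine ⟨E, ⟨hE, ?_⟩, hEr⟩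
      replace hD0 : Phi hNO D = 0 := hD0
      change Phi hNO _ = 0
      apply replica_nilp (Phi_replica hNO hD.2 φ hEr)
      rw [hD0]; exact IsNilpotent.zero
  let a : Submodule k (Module.End k O) :=
    { carrier := {x | x ∈ LieD hS ∧ ∀ y ∈ r, BF hX x y = 0}
      add_mem' := by
        rintro a b ⟨h1, h2⟩ ⟨h3, h4⟩
        exact ⟨Submodule.add_mem _ h1 h3, fun E hE => by simp [h2 E hE, h4 E hE]⟩
      zero_mem' := ⟨Submodule.zero_mem _, fun E hE => by simp⟩
      smul_mem' := by
        rintro c a ⟨h1, h2⟩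
        exact ⟨Submodule.smul_mem _ c h1, fun E hE => by simp [h2 E hE]⟩ }
  have hale : a ≤ LieD hS := fun x hx => hx.1
  have hrfd : FiniteDimensional k r := fd_of_le (hr.le)
  have hafd : FiniteDimensional k a := fd_of_le hale
  have hdec : ∀ x ∈ LieD hS, ∃ y ∈ r, x - y ∈ a := by
    intro x hx
    obtain ⟨y, hy, hyx⟩ := repr_fun (BF hX) (BF_symm hX) r (H.nondeg hr) (BF hX x)
    refine ⟨y, hy, Submodule.sub_mem _ hx hy.1, fun z hz => ?_⟩
    have := hyx z hz
    simp [this]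
  -- the form of `N`
  let hU : ∀ _ : Unit, IsO O (subRep ρ N hN) := fun _ => hNO
  let B := BF hU
  have hBdef : ∀ x y, B x y = LinearMap.trace k N (Phi hNO x * Phi hNO y) := by
    intro x y
    simp [B, BF_apply]
  have hBs : ∀ x y, B x y = B y x := BF_symm hU
  have hBn : ∀ x ∈ a, (∀ y ∈ a, B x y = 0) → x = 0 := by
    intro x hx h0
    have h1 : ∀ y ∈ LieD hS, B x y = 0 := by
      intro y hy
      obtain ⟨z, hz, hyz⟩ := hdec y hy
      have e : B x y = B x (y - z) + B x z := by rw [← map_add]; simp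
      rw [e, h0 _ hyz, hBdef x z, LinearMap.mem_ker.1 hz.2]
      simp
    have h2 : Phi hNO x = 0 := kills hU (fun _ => hirr) H.good hx.1 h1 ()
    have h3 : x ∈ r := ⟨hx.1, h2⟩
    exact H.nondeg hr x h3 fun y hy => hx.2 y hy
  have haAd : ∀ g, ∀ x ∈ a, Ad hS g x ∈ a := by
    intro g x hx
    refine ⟨H.good.conj g x hx.1, fun y hy => ?_⟩
    have h1 := hr.conj g⁻¹ y hy
    have h2 := BF_conj hX hx.1.2 h1.1.2 g
    rw [Ad_Ad_inv] at h2
    rw [h2]; exact hx.2 _ h1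
  obtain ⟨n, b, b', hb, hb', hbb, hn0, hcas⟩ := casimir_exists B hBs a hBn
  let c : Module.End k T := ∑ i, Phi h (b i) * Phi h (b' i)
  have hcN : ∀ t, c t ∈ N := by
    intro t
    simp only [c, LinearMap.sum_apply, Module.End.mul_apply]
    exact Submodule.sum_mem _ fun i _ => hTN _ (hale (hb i)) _
  refine ⟨c, ?_, hcN, ?_⟩
  · intro g
    let m : Module.End k O →ₗ[k] Module.End k O →ₗ[k] Module.End k T :=
      (LinearMap.mul k (Module.End k T)).compl₁₂ (Phi h) (Phi h)
    have key := hcas (Module.End k T) m (Ad hS g) (Ad hS g⁻¹) (haAd g) (haAd g⁻¹)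
      (fun x _ => Ad_Ad_inv hS g x)
      (by
        intro x hx y hy
        have h2 := BF_conj hU hx.1.2 (haAd g⁻¹ y hy).1.2 g
        have h3 := Ad_Ad_inv hS g y
        change BF hU (Ad hS g x) (Ad hS g (Ad hS g⁻¹ y)) = _ at h2
        rw [h3] at h2
        exact h2)
    have e1 : ∀ x ∈ a, ∀ y ∈ a, m (Ad hS g x) (Ad hS g y) = ρ g * m x y * ρ g⁻¹ := by
      intro x hx y hy
      change Phi h (Ad hS g x) * Phi h (Ad hS g y) = ρ g * (Phi h x * Phi h y) * ρ g⁻¹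
      rw [Phi_Ad h hx.1.2, Phi_Ad h hy.1.2]
      have h1 : ρ g⁻¹ * ρ g = 1 := by rw [← map_mul]; simp
      have : ρ g * Phi h x * ρ g⁻¹ * (ρ g * Phi h y * ρ g⁻¹) =
        ρ g * Phi h x * (ρ g⁻¹ * ρ g) * Phi h y * ρ g⁻¹ := by simp only [mul_assoc]
      rw [this, h1]; simp only [mul_assoc, one_mul]
    have e2 : ρ g * c * ρ g⁻¹ = c := by
      have e3 : c = ∑ i, m (b i) (b' i) := rfl
      rw [e3]
      conv_rhs => rw [← key]
      rw [Finset.mul_sum, Finset.sum_mul]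
      exact Finset.sum_congr rfl fun i _ => (e1 _ (hb i) _ (hb' i)).symm
    conv_rhs => rw [← e2]
    rw [mul_assoc (ρ g * c), ← map_mul]
    simp
  · have hsum : c.restrict (fun t _ => hcN t) = ∑ i, Phi hNO (b i) * Phi hNO (b' i) := by
      ext ⟨t, ht⟩
      have e : ∀ (D : Module.End k O) (n : N), ((Phi hNO D n : N) : T) = Phi h D n := fun D n =>
        (Phi_map hNO h N.subtype (fun _ _ => rfl) D n).symm
      change c t = _
      simp only [c, LinearMap.sum_apply, Module.End.mul_apply, Submodule.coe_sum, e]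
    rw [hsum, map_sum]
    have : ∀ i, LinearMap.trace k N (Phi hNO (b i) * Phi hNO (b' i)) = 1 := by
      intro i
      rw [← hBdef]; exact hbb i
    rw [Finset.sum_congr rfl fun i _ => this i]
    simp only [Finset.sum_const, Finset.card_univ, Fintype.card_fin, nsmul_eq_mul, mul_one]
    rw [Nat.cast_ne_zero]
    intro h0
    obtain ⟨D, hD, hD0⟩ := hne
    obtain ⟨y, hy, hDy⟩ := hdec D hD
    rw [hn0 h0, Submodule.mem_bot, sub_eq_zero] at hDy
    rw [hDy] at hD0
    exact hD0 hy.2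

lemma exists_invariant {hS : Stab O} {hX : ∀ i, IsO O (ρX i)} (H : Setup hS hX)
    (hfin : ∀ (T : Type) [AddCommGroup T] [Module k T] [FiniteDimensional k T]
      (ρ : Representation k G T) (h : IsO O ρ), (∀ D ∈ LieD hS, Phi h D = 0) →
        (Set.range ρ).Finite) :
    ∀ (n : ℕ) (T : Type) [AddCommGroup T] [Module k T] [FiniteDimensional k T]
      (ρ : Representation k G T) (_ : IsO O ρ) (p : Dual k T), finrank k T = n →
      (∀ g t, p (ρ g t) = p t) → p ≠ 0 → ∃ t, p t ≠ 0 ∧ ∀ g, ρ g t = t := by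
  classical
  intro n
  induction n using Nat.strong_induction_on with
  | _ n ih =>
  intro T _ _ _ ρ h p hdim hp hp0
  by_cases hsub : ∃ S : Submodule k T, S ≠ ⊤ ∧ (∀ g, ∀ t ∈ S, ρ g t ∈ S) ∧ ∃ s ∈ S, p s ≠ 0
  · obtain ⟨S, hSt, hSs, s, hs, hps⟩ := hsub
    obtain ⟨t, ht, hgt⟩ := ih (finrank k S) (hdim ▸ Submodule.finrank_lt hSt) S
      (subRep ρ S hSs) (subRep_isO h S hSs) (p ∘ₗ S.subtype) rfl (fun g t => hp g t)
      (fun h0 => hps (congrArg (fun f => f ⟨s, hs⟩) h0))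
    exact ⟨t, ht, fun g => congrArg Subtype.val (hgt g)⟩
  push Not at hsub
  let N := LinearMap.ker p
  have hN : ∀ g, ∀ t ∈ N, ρ g t ∈ N := by
    intro g t ht
    rw [LinearMap.mem_ker] at ht ⊢
    rw [hp, ht]
  have hTN : ∀ D ∈ LieD hS, ∀ t, Phi h D t ∈ N := fun D hD t => Phi_functional h p hp hD t
  by_cases htriv : ∀ D ∈ LieD hS, Phi (subRep_isO h N hN) D = 0
  · -- finite group case
    have h0 := unip_trivial H h (by
      intro D hD E hE
      ext t
      have := Phi_map (subRep_isO h N hN) h N.subtype (fun _ _ => rfl) D ⟨_, hTN E hE t⟩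
      rw [htriv D hD] at this
      simpa using this)
    have hf := hfin T ρ h h0
    obtain ⟨t, ht⟩ : ∃ t, p t ≠ 0 := by
      by_contra! hcon
      exact hp0 (LinearMap.ext hcon)
    refine ⟨∑ a ∈ hf.toFinset, a t, ?_, ?_⟩
    · rw [map_sum, Finset.sum_congr rfl (g := fun _ => p t)]
      · simp only [Finset.sum_const, nsmul_eq_mul]
        refine mul_ne_zero ?_ ht
        rw [Nat.cast_ne_zero]
        exact (Finset.card_pos.2 ⟨ρ 1, (Set.Finite.mem_toFinset hf).2 ⟨1, rfl⟩⟩).ne'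
      · intro a ha
        obtain ⟨g, rfl⟩ := (Set.Finite.mem_toFinset hf).1 ha
        exact hp g t
    · intro g
      rw [map_sum]
      refine Finset.sum_nbij' (fun a => ρ g * a) (fun a => ρ g⁻¹ * a) ?_ ?_ ?_ ?_ ?_
      · intro a ha
        obtain ⟨x, rfl⟩ := (Set.Finite.mem_toFinset hf).1 ha
        exact (Set.Finite.mem_toFinset hf).2 ⟨g * x, map_mul _ _ _⟩
      · intro a ha
        obtain ⟨x, rfl⟩ := (Set.Finite.mem_toFinset hf).1 ha
        exact (Set.Finite.mem_toFinset hf).2 ⟨g⁻¹ * x, map_mul _ _ _⟩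
      · intro a _
        rw [← mul_assoc, ← map_mul]; simp
      · intro a _
        rw [← mul_assoc, ← map_mul]; simp
      · intro a _
        rfl
  · push Not at htriv
    have hntriv : Nontrivial N := by
      obtain ⟨D, _, hD⟩ := htriv
      by_contra hcon
      rw [not_nontrivial_iff_subsingleton] at hcon
      exact hD (LinearMap.ext fun x => Subsingleton.elim _ _)
    have hirr : Irr (subRep ρ N hN) := by
      refine ⟨hntriv, fun S hSs => ?_⟩
      by_contra! hcon
      obtain ⟨hb, ht⟩ := hcon
      let N' := S.map N.subtype
      have hN'N : N' ≤ N := Submodule.map_subtype_le N S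
      have hN' : ∀ g, ∀ t ∈ N', ρ g t ∈ N' := by
        rintro g _ ⟨s, hs, rfl⟩
        exact ⟨_, hSs g s hs, rfl⟩
      have hfr : finrank k N' ≠ 0 := by
        rw [Ne, Submodule.finrank_eq_zero]
        intro h0
        exact hb (Submodule.map_injective_of_injective N.subtype_injective (h0.trans (Submodule.map_bot _).symm))
      let q : Dual k (T ⧸ N') := N'.liftQ p hN'N
      obtain ⟨t', ht', hgt'⟩ := ih (finrank k (T ⧸ N'))
        (by have := N'.finrank_quotient_add_finrank; omega) (T ⧸ N')
        (quoRep ρ N' hN') (quoRep_isO h N' hN') q rfl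
        (by
          intro g t
          obtain ⟨t, rfl⟩ := N'.mkQ_surjective t
          exact hp g t)
        (by
          intro h0
          apply hp0
          ext t
          exact congrArg (fun f => f (N'.mkQ t)) h0)
      obtain ⟨t, rfl⟩ := N'.mkQ_surjective t'
      have hpt : p t ≠ 0 := ht'
      have hmem : ∀ g, ρ g t - t ∈ N' := by
        intro g
        have := hgt' g
        exact (Submodule.Quotient.eq N').1 this
      let S' := N' ⊔ k ∙ t
      have hS' : S' ≠ ⊤ := by
        intro htop
        apply ht
        rw [eq_top_iff]
        rintro ⟨x, hx⟩ -
        have : x ∈ S' := htop ▸ Submodule.mem_top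
        obtain ⟨y, hy, z, hz, rfl⟩ := Submodule.mem_sup.1 this
        obtain ⟨c, rfl⟩ := Submodule.mem_span_singleton.1 hz
        have h1 : p (y + c • t) = 0 := hx
        have h2 : p y = 0 := hN'N hy
        rw [map_add, h2, map_smul, zero_add, smul_eq_mul] at h1
        have hc : c = 0 := (mul_eq_zero.1 h1).resolve_right hpt
        obtain ⟨s, hs, hsy⟩ := hy
        have : s = ⟨y + c • t, hx⟩ := by ext; simp [← hsy, hc]
        rw [← this]; exact hs
      apply hpt
      refine hsub S' hS' ?_ t (Submodule.mem_sup_right (Submodule.mem_span_singleton_self t))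
      intro g x hx
      obtain ⟨y, hy, z, hz, rfl⟩ := Submodule.mem_sup.1 hx
      obtain ⟨c, rfl⟩ := Submodule.mem_span_singleton.1 hz
      have e : ρ g (y + c • t) = (ρ g y + c • (ρ g t - t)) + c • t := by
        simp [smul_sub, add_assoc]
      rw [e]
      exact Submodule.add_mem_sup (Submodule.add_mem _ (hN' g y hy) (Submodule.smul_mem _ _ (hmem g)))
        (Submodule.mem_span_singleton.2 ⟨c, rfl⟩)
    obtain ⟨c, hcg, hcN, htr⟩ := exists_casimir H h N hN hirr hTN htriv
    have hker : ∀ x ∈ N, c x = 0 → x = 0 := by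
      let S : Submodule k N := LinearMap.ker (c.restrict (fun t _ => hcN t) : N →ₗ[k] N)
      have hmemS : ∀ x : N, x ∈ S ↔ c x = 0 := by
        intro x
        rw [LinearMap.mem_ker]
        exact ⟨fun h => congrArg Subtype.val h, fun h => Subtype.ext h⟩
      rcases hirr.eq S (by
        intro g x hx
        rw [hmemS] at hx ⊢
        have := congrArg (fun f => f x.1) (hcg g)
        change c (ρ g x) = 0
        simp only [Module.End.mul_apply] at this
        rw [← this, hx, map_zero]) with hb | ht
      · intro x hx hcx
        have : (⟨x, hx⟩ : N) ∈ S := (hmemS _).2 hcx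
        rw [hb, Submodule.mem_bot] at this
        exact congrArg Subtype.val this
      · exfalso
        apply htr
        have : (c.restrict (fun t _ => hcN t) : N →ₗ[k] N) = 0 := LinearMap.ker_eq_top.1 ht
        rw [this, map_zero]
    have hNlt : finrank k N < finrank k T := by
      apply Submodule.finrank_lt
      intro htop
      exact hp0 (LinearMap.ker_eq_top.1 htop)
    let c' : T →ₗ[k] N := c.codRestrict N hcN
    have hc' : LinearMap.ker c' ≠ ⊥ := LinearMap.ker_ne_bot_of_finrank_lt hNlt
    obtain ⟨t, ht, ht0⟩ := Submodule.exists_mem_ne_zero_of_ne_bot hc'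
    have hct : c t = 0 := congrArg Subtype.val (LinearMap.mem_ker.1 ht)
    refine ⟨t, fun hpt => ht0 (hker t hpt hct), fun g => ?_⟩
    rw [← sub_eq_zero]
    apply hker
    · change p (ρ g t - t) = 0
      rw [map_sub, hp, sub_self]
    · have := congrArg (fun f => f t) (hcg g)
      simp only [Module.End.mul_apply] at this
      rw [map_sub, ← this, hct, map_zero, sub_zero]

end step
end Chev

namespace Chev
open Module

section euler

lemma euler_fd {k : Type} [Field k] {A : Type} [CommRing A] [Algebra k A] [IsNoetherianRing A]
    (ε : A →ₐ[k] k) : ∃ (n : ℕ) (x : Fin n → A) (d : Fin n → A →ₗ[k] k),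
      (∀ i, ε (x i) = 0) ∧ (∀ i a b, d i (a * b) = ε a * d i b + ε b * d i a) ∧
      ∀ y, ε y = 0 → y - ∑ i, algebraMap k A (d i y) * x i ∈ (RingHom.ker ε) ^ 2 := by
  classical
  set m : Ideal A := RingHom.ker ε with hm
  have hmem : ∀ a, a ∈ m ↔ ε a = 0 := fun a => RingHom.mem_ker
  have hsub : ∀ a, a - algebraMap k A (ε a) ∈ m := by
    intro a; rw [hmem]; simp
  let N : Submodule k A := (m ^ 2).restrictScalars k ⊔ k ∙ (1 : A)
  have hN2 : ∀ a ∈ m ^ 2, a ∈ N := fun a ha => Submodule.mem_sup_left ha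
  have hN1 : ∀ c : k, algebraMap k A c ∈ N := fun c =>
    Submodule.mem_sup_right (by rw [Algebra.algebraMap_eq_smul_one]
                                exact Submodule.smul_mem _ _ (Submodule.mem_span_singleton_self _))
  have hNm : ∀ a ∈ N, ε a = 0 → a ∈ m ^ 2 := by
    intro a ha h0
    obtain ⟨y, hy, z, hz, rfl⟩ := Submodule.mem_sup.1 ha
    obtain ⟨c, rfl⟩ := Submodule.mem_span_singleton.1 hz
    have hy' : y ∈ m ^ 2 := hy
    have h1 : ε y = 0 := (hmem y).1 (Ideal.pow_le_self two_ne_zero hy')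
    rw [map_add, h1, zero_add, map_smul, map_one, smul_eq_mul, mul_one] at h0
    rw [h0]; simpa using hy'
  obtain ⟨s, hs⟩ := (IsNoetherian.noetherian m : m.FG)
  have hfd : FiniteDimensional k (A ⧸ N) := by
    refine ⟨⟨s.image N.mkQ, ?_⟩⟩
    rw [eq_top_iff]
    rintro q -
    obtain ⟨f, rfl⟩ := N.mkQ_surjective q
    set P := Submodule.span k ((s.image N.mkQ : Finset (A ⧸ N)) : Set (A ⧸ N)) with hP
    have h1 : ∀ y ∈ m, N.mkQ y ∈ P := by
      intro y hy
      have hy' : y ∈ Submodule.span A (s : Set A) := by rw [hs]; exact hy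
      induction hy' using Submodule.span_induction with
      | mem x hx => exact Submodule.subset_span (by simp only [Finset.coe_image]; exact ⟨x, hx, rfl⟩)
      | zero => simp
      | add x z hx hz h1 h2 =>
        rw [map_add]; exact Submodule.add_mem _ (h1 (hs ▸ hx)) (h2 (hs ▸ hz))
      | smul a x hx h1 =>
        have hxm : x ∈ m := hs ▸ hx
        have e : a • x = ε a • x + (a - algebraMap k A (ε a)) * x := by
          rw [smul_eq_mul, sub_mul, Algebra.smul_def]; ring
        have e2 : N.mkQ ((a - algebraMap k A (ε a)) * x) = 0 := by
          rw [Submodule.mkQ_apply, Submodule.Quotient.mk_eq_zero]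
          apply hN2
          rw [pow_two]; exact Ideal.mul_mem_mul (hsub a) hxm
        rw [e, map_add, e2, add_zero, map_smul]
        exact Submodule.smul_mem _ _ (h1 hxm)
    have h2 : N.mkQ f = N.mkQ (f - algebraMap k A (ε f)) := by
      rw [map_sub, eq_comm, sub_eq_self, Submodule.mkQ_apply, Submodule.Quotient.mk_eq_zero]
      exact hN1 _
    rw [h2]; exact h1 _ (hsub f)
  let b := Module.finBasis k (A ⧸ N)
  choose x' hx' using fun i => N.mkQ_surjective (b i)
  have hx0 : ∀ i, N.mkQ (x' i - algebraMap k A (ε (x' i))) = b i := by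
    intro i
    rw [map_sub, hx', sub_eq_self, Submodule.mkQ_apply, Submodule.Quotient.mk_eq_zero]
    exact hN1 _
  refine ⟨_, fun i => x' i - algebraMap k A (ε (x' i)), fun i => b.coord i ∘ₗ N.mkQ,
    fun i => (hmem _).1 (hsub _), fun i p q => ?_, fun y hy => ?_⟩
  · have e : p * q = (p - algebraMap k A (ε p)) * (q - algebraMap k A (ε q)) +
      ε p • q + ε q • p - algebraMap k A (ε p * ε q) := by
      simp only [Algebra.smul_def, map_mul]; ring
    have e1 : N.mkQ ((p - algebraMap k A (ε p)) * (q - algebraMap k A (ε q))) = 0 := by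
      rw [Submodule.mkQ_apply, Submodule.Quotient.mk_eq_zero]
      apply hN2
      rw [pow_two]; exact Ideal.mul_mem_mul (hsub p) (hsub q)
    have e2 : N.mkQ (algebraMap k A (ε p * ε q)) = 0 := by
      rw [Submodule.mkQ_apply, Submodule.Quotient.mk_eq_zero]
      exact hN1 _
    have e3 : N.mkQ (p * q) = ε p • N.mkQ q + ε q • N.mkQ p := by
      rw [e, map_sub, map_add, map_add, e1, e2, map_smul, map_smul]; simp
    simp only [LinearMap.comp_apply, e3, map_add, map_smul, smul_eq_mul]
  · apply hNm
    · rw [← Submodule.Quotient.mk_eq_zero, ← Submodule.mkQ_apply, map_sub, map_sum, sub_eq_zero]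
      conv_lhs => rw [← b.sum_repr (N.mkQ y)]
      refine Finset.sum_congr rfl fun i _ => ?_
      rw [← Algebra.smul_def, map_smul, hx0]
      rfl
    · rw [map_sub, hy, map_sum, zero_sub, neg_eq_zero]
      apply Finset.sum_eq_zero
      intro i _
      rw [map_mul]
      simp

lemma euler_trick {k : Type} [Field k] [CharZero k] {A : Type} [CommRing A] [Algebra k A]
    [IsNoetherianRing A] (ε : A →ₐ[k] k) (S : Set (A →ₗ[k] A))
    (hS : ∀ D ∈ S, ∀ a b, D (a * b) = a * D b + b * D a)
    (hlift : ∀ d : A →ₗ[k] k, (∀ a b, d (a * b) = ε a * d b + ε b * d a) →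
      ∃ D ∈ S, ∀ a, ε (D a) = d a)
    (f : A) (hf : ε f = 0) (hk : ∀ D ∈ S, D f = 0) : ∃ r, ε r = 0 ∧ r * f = f := by
  obtain ⟨n, x, d, hx, hd, hxd⟩ := euler_fd ε
  choose D hD hDd using fun i => hlift (d i) (hd i)
  set m : Ideal A := RingHom.ker ε with hm
  have hmem : ∀ a, a ∈ m ↔ ε a = 0 := fun a => RingHom.mem_ker
  let E : A →ₗ[k] A := ∑ i, LinearMap.mulLeft k (x i) ∘ₗ D i
  have hE : ∀ a, E a = ∑ i, x i * D i a := by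
    intro a; simp [E, LinearMap.sum_apply]
  have hEmul : ∀ a b, E (a * b) = a * E b + b * E a := by
    intro a b
    simp only [hE, Finset.mul_sum, ← Finset.sum_add_distrib]
    refine Finset.sum_congr rfl fun i _ => ?_
    rw [hS _ (hD i)]; ring
  have hE1 : ∀ y ∈ m, E y - y ∈ m ^ 2 := by
    intro y hy
    have h1 := hxd y ((hmem y).1 hy)
    have e : E y - y = ∑ i, x i * (D i y - algebraMap k A (d i y)) -
        (y - ∑ i, algebraMap k A (d i y) * x i) := by
      rw [hE]
      simp only [mul_sub, Finset.sum_sub_distrib, mul_comm]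
      ring
    rw [e]
    refine Ideal.sub_mem _ (Ideal.sum_mem _ fun i _ => ?_) h1
    rw [pow_two]
    refine Ideal.mul_mem_mul ((hmem _).2 (hx i)) ((hmem _).2 ?_)
    rw [map_sub, hDd]; simp
  have hEn : ∀ n : ℕ, ∀ y ∈ m ^ n, E y - (n : A) * y ∈ m ^ (n + 1) := by
    intro n
    induction n with
    | zero =>
      intro y _
      rw [Nat.cast_zero, zero_mul, sub_zero, zero_add, pow_one, hE]
      exact Ideal.sum_mem _ fun i _ => Ideal.mul_mem_right _ _ ((hmem _).2 (hx i))
    | succ n ih =>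
      intro y hy
      rw [pow_succ] at hy
      induction hy using Submodule.mul_induction_on' with
      | mem_mul_mem a ha b hb =>
        have e : E (a * b) - ((n + 1 : ℕ) : A) * (a * b) =
            a * (E b - b) + (E a - n * a) * b := by
          rw [hEmul]; push_cast; ring
        rw [e]
        refine Ideal.add_mem _ ?_ ?_
        · rw [show n + 1 + 1 = n + 2 from rfl, pow_add]
          exact Ideal.mul_mem_mul ha (hE1 b hb)
        · rw [pow_succ]
          exact Ideal.mul_mem_mul (ih a ha) hb
      | add a _ b _ h1 h2 =>
        have e : E (a + b) - ((n + 1 : ℕ) : A) * (a + b) =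
          (E a - ((n + 1 : ℕ) : A) * a) + (E b - ((n + 1 : ℕ) : A) * b) := by
          rw [map_add]; ring
        rw [e]; exact Ideal.add_mem _ h1 h2
  have hEf : E f = 0 := by
    rw [hE]; exact Finset.sum_eq_zero fun i _ => by rw [hk _ (hD i), mul_zero]
  have hall : ∀ n : ℕ, f ∈ m ^ (n + 1) := by
    intro n
    induction n with
    | zero => rw [zero_add, pow_one]; exact (hmem f).2 hf
    | succ n ih =>
      have h1 := hEn _ f ih
      rw [hEf, zero_sub, Ideal.neg_mem_iff] at h1
      have h2 := Ideal.mul_mem_left _ (algebraMap k A ((n + 1 : ℕ) : k)⁻¹) h1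
      have e : algebraMap k A ((n + 1 : ℕ) : k)⁻¹ * (((n + 1 : ℕ) : A) * f) = f := by
        rw [← mul_assoc, ← map_natCast (algebraMap k A), ← map_mul, inv_mul_cancel₀, map_one,
          one_mul]
        exact Nat.cast_ne_zero.2 (Nat.succ_ne_zero n)
      rwa [e] at h2
  have hinf : f ∈ (⨅ i : ℕ, m ^ i • ⊤ : Submodule A A) := by
    rw [Submodule.mem_iInf]
    intro i
    rw [smul_eq_mul]
    have : m ^ i * ⊤ = m ^ i := Ideal.mul_top _
    rw [this]
    exact Ideal.pow_le_pow_right (Nat.le_succ i) (hall i)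
  obtain ⟨⟨r, hr⟩, h⟩ := (Ideal.mem_iInf_smul_pow_eq_bot_iff m f).1 hinf
  exact ⟨r, (hmem r).1 hr, h⟩

end euler
end Chev

namespace Chev
open Module

section fin
variable {k : Type} [Field k] [CharZero k] {G : Type} [Group G] {O : Subalgebra k (G → k)}

lemma killed_finite [IsNoetherianRing O] (hS : Stab O)
    (hlift : ∀ d : O →ₗ[k] k, (∀ a b, d (a * b) = ev O 1 a * d b + ev O 1 b * d a) →
      ∃ D ∈ LieD hS, ∀ a, ev O 1 (D a) = d a)
    (f : O) (hk : ∀ D ∈ LieD hS, D f = 0) : (Set.range f.1).Finite := by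
  classical
  have h1 : ∀ g : G, ∃ u : O, u.1 g = 1 ∧ ∀ x, u.1 x * (f.1 x - f.1 g) = 0 := by
    intro g
    obtain ⟨r, hr, hrf⟩ := euler_trick (ev O 1) (LieD hS : Set (Module.End k O))
      (fun D hD => hD.1) hlift (Lop hS g f - f.1 g • 1) (by simp)
      (by
        intro D hD
        have hD' : D ∈ LieD hS := hD
        rw [map_sub, map_smul, LieD.one hD', hD'.2 g, hk D hD', map_zero, smul_zero, sub_zero])
    refine ⟨Lop hS g⁻¹ (1 - r), ?_, fun x => ?_⟩
    · have : r.1 1 = 0 := hr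
      simp [this]
    · have := congrArg (fun q : O => q.1 (g⁻¹ * x)) hrf
      simp at this
      simp only [Lop_apply]
      have e : (1 - r : O).1 (g⁻¹ * x) = 1 - r.1 (g⁻¹ * x) := rfl
      rw [e, sub_mul, this]; ring
  choose u hu1 hu using h1
  obtain ⟨s, hs, hspan⟩ := (Submodule.fg_span_iff_fg_span_finset_subset (R := O) (Set.range u)).1
    (IsNoetherian.noetherian _)
  have hs' : ∀ a : O, a ∈ s → ∃ g : G, u g = a := fun a ha => hs ha
  choose! w hw using hs'
  refine Set.Finite.subset (Finset.finite_toSet (s.image fun a => f.1 (w a))) ?_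
  rintro _ ⟨x, rfl⟩
  by_contra hcon
  have h0 : ∀ a ∈ s, a.1 x = 0 := by
    intro a ha
    by_contra hne
    apply hcon
    simp only [Finset.coe_image]
    refine ⟨a, ha, ?_⟩
    have := hu (w a) x
    rw [hw a ha] at this
    exact (sub_eq_zero.1 ((mul_eq_zero.1 this).resolve_left hne)).symm
  have h2 : ∀ a ∈ Submodule.span O (s : Set O), a.1 x = 0 := by
    intro a ha
    induction ha using Submodule.span_induction with
    | mem a ha => exact h0 a ha
    | zero => rfl
    | add a b _ _ h1 h2 => change a.1 x + b.1 x = 0; rw [h1, h2, add_zero]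
    | smul a b _ h1 => change a.1 x * b.1 x = 0; rw [h1, mul_zero]
  have h3 := h2 (u x) (hspan ▸ Submodule.subset_span ⟨x, rfl⟩)
  rw [hu1] at h3
  exact one_ne_zero h3

lemma rep_finite [IsNoetherianRing O] (hS : Stab O)
    (hlift : ∀ d : O →ₗ[k] k, (∀ a b, d (a * b) = ev O 1 a * d b + ev O 1 b * d a) →
      ∃ D ∈ LieD hS, ∀ a, ev O 1 (D a) = d a)
    (T : Type) [AddCommGroup T] [Module k T] [FiniteDimensional k T]
    (ρ : Representation k G T) (h : IsO O ρ) (h0 : ∀ D ∈ LieD hS, Phi h D = 0) :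
    (Set.range ρ).Finite := by
  classical
  let b := Module.finBasis k T
  have hc : ∀ i j, (Set.range (mc h (b.coord i) (b j)).1).Finite := by
    intro i j
    apply killed_finite hS hlift
    intro D hD
    rw [← mc_Phi h hD.2, h0 D hD]
    simp
  let F : Module.End k T → (Fin (finrank k T) → Fin (finrank k T) → k) :=
    fun A i j => b.coord i (A (b j))
  have hF : Function.Injective F := by
    intro A B hAB
    apply b.ext
    intro j
    apply b.ext_elem
    intro i
    exact congrFun (congrFun hAB i) j
  apply Set.Finite.of_finite_image _ hF.injOn
  refine Set.Finite.subset (Set.Finite.pi' fun i => Set.Finite.pi' fun j => hc i j) ?_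
  rintro _ ⟨_, ⟨g, rfl⟩, rfl⟩
  intro i j
  exact ⟨g, rfl⟩

end fin

section Oalg
variable {k : Type} [Field k] {G : Type} [Group G]
variable {ι : Type} [Fintype ι] {X : ι → Type} [∀ i, AddCommGroup (X i)]
    [∀ i, Module k (X i)] [∀ i, FiniteDimensional k (X i)] (ρX : ∀ i, Representation k G (X i))

/-- Generators: all matrix coefficients. -/
def gens : Set (G → k) := {f | ∃ i, ∃ (l : Dual k (X i)) (w : X i), f = fun g => l (ρX i g w)}

/-- The algebra generated by the matrix coefficients. -/
def Oalg : Subalgebra k (G → k) := Algebra.adjoin k (gens ρX)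

lemma Oalg_isO (i : ι) : IsO (Oalg ρX) (ρX i) := fun l w =>
  Algebra.subset_adjoin ⟨i, l, w, rfl⟩

lemma Oalg_induction {p : (f : Oalg ρX) → Prop}
    (hmem : ∀ i l w, p (mc (Oalg_isO ρX i) l w)) (hc : ∀ c : k, p (algebraMap k _ c))
    (hadd : ∀ a b, p a → p b → p (a + b)) (hmul : ∀ a b, p a → p b → p (a * b))
    (f : Oalg ρX) : p f := by
  obtain ⟨f, hf⟩ := f
  induction hf using Algebra.adjoin_induction with
  | mem x hx =>
    obtain ⟨i, l, w, rfl⟩ := hx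
    exact hmem i l w
  | algebraMap r => exact hc r
  | add x y hx hy h1 h2 => exact hadd _ _ h1 h2
  | mul x y hx hy h1 h2 => exact hmul _ _ h1 h2

lemma Oalg_stab : Stab (Oalg ρX) := by
  refine ⟨fun f hf g => ?_, fun f hf g => ?_⟩
  · refine Oalg_induction ρX (p := fun f => (fun x => f.1 (g * x)) ∈ Oalg ρX) ?_ ?_ ?_ ?_ ⟨f, hf⟩
    · intro i l w
      convert Oalg_isO ρX i (l ∘ₗ ρX i g) w using 2
      simp
    · intro c; exact Subalgebra.algebraMap_mem _ c
    · intro a b ha hb; exact Subalgebra.add_mem _ ha hb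
    · intro a b ha hb; exact Subalgebra.mul_mem _ ha hb
  · refine Oalg_induction ρX (p := fun f => (fun x => f.1 (x * g)) ∈ Oalg ρX) ?_ ?_ ?_ ?_ ⟨f, hf⟩
    · intro i l w
      convert Oalg_isO ρX i l (ρX i g w) using 2
      simp
    · intro c; exact Subalgebra.algebraMap_mem _ c
    · intro a b ha hb; exact Subalgebra.add_mem _ ha hb
    · intro a b ha hb; exact Subalgebra.mul_mem _ ha hb

lemma Oalg_inv (hinv : ∀ i (l : Dual k (X i)) (w : X i), (fun g => l (ρX i g⁻¹ w)) ∈ Oalg ρX) (f : G → k)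
    (hf : f ∈ Oalg ρX) : (fun g => f g⁻¹) ∈ Oalg ρX := by
  refine Oalg_induction ρX (p := fun f => (fun x => f.1 x⁻¹) ∈ Oalg ρX) ?_ ?_ ?_ ?_ ⟨f, hf⟩
  · intro i l w
    exact hinv i l w
  · intro c; exact Subalgebra.algebraMap_mem _ c
  · intro a b ha hb; exact Subalgebra.add_mem _ ha hb
  · intro a b ha hb; exact Subalgebra.mul_mem _ ha hb

lemma Oalg_faithful (D : Module.End k (Oalg ρX)) (hD : D ∈ LieD (Oalg_stab ρX))
    (h : ∀ i, Phi (Oalg_isO ρX i) D = 0) : D = 0 := by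
  ext1 f
  rw [LinearMap.zero_apply]
  induction f using Oalg_induction with
  | hmem i l w => rw [← mc_Phi _ hD.2, h i]; simp
  | hc c => rw [Algebra.algebraMap_eq_smul_one, map_smul, LieD.one hD, smul_zero]
  | hadd a b h1 h2 => rw [map_add, h1, h2, add_zero]
  | hmul a b h1 h2 => rw [hD.1, h1, h2]; simp

lemma Oalg_top [IsAlgClosed k] (D : Module.End k (Oalg ρX)) (hD : D ∈ LieD (Oalg_stab ρX)) :
    ⨆ c, D.maxGenEigenspace c = ⊤ := by
  rw [eq_top_iff]
  rintro f -
  induction f using Oalg_induction with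
  | hmem i l w =>
    have hw : w ∈ ⨆ c, (Phi (Oalg_isO ρX i) D).maxGenEigenspace c := by
      rw [Module.End.iSup_maxGenEigenspace_eq_top]; trivial
    induction hw using Submodule.iSup_induction' with
    | mem c w hw => exact Submodule.mem_iSup_of_mem c (mc_gen _ hD.2 l c w hw)
    | zero => rw [map_zero]; exact Submodule.zero_mem _
    | add x y _ _ h1 h2 => rw [map_add]; exact Submodule.add_mem _ h1 h2
  | hc c =>
    apply Submodule.mem_iSup_of_mem 0
    rw [Module.End.mem_maxGenEigenspace]
    refine ⟨1, ?_⟩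
    rw [Algebra.algebraMap_eq_smul_one]
    simp [LieD.one hD]
  | hadd a b h1 h2 => exact Submodule.add_mem _ h1 h2
  | hmul a b ha hb =>
    induction ha using Submodule.iSup_induction' with
    | zero => rw [zero_mul]; exact Submodule.zero_mem _
    | add x y _ _ hx hy => rw [add_mul]; exact Submodule.add_mem _ hx hy
    | mem c a ha =>
      induction hb using Submodule.iSup_induction' with
      | zero => rw [mul_zero]; exact Submodule.zero_mem _
      | add x y _ _ hx hy => rw [mul_add]; exact Submodule.add_mem _ hx hy
      | mem d b hb => exact Submodule.mem_iSup_of_mem (c + d) (gen_mul hD.1 ha hb)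

lemma Oalg_noeth : IsNoetherianRing (Oalg ρX) := by
  classical
  let B := fun i => Module.finBasis k (X i)
  let s : Set (G → k) := ⋃ i, ⋃ p, ⋃ q, {fun g => (B i).coord p (ρX i g (B i q))}
  have hs : s.Finite := Set.finite_iUnion fun i => Set.finite_iUnion fun p =>
    Set.finite_iUnion fun q => Set.finite_singleton _
  have : Oalg ρX = Algebra.adjoin k s := by
    apply le_antisymm
    · apply Algebra.adjoin_le
      rintro _ ⟨i, l, w, rfl⟩
      have e : (fun g => l (ρX i g w)) = ∑ p, ∑ q, (l (B i p) * (B i).repr w q) •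
          (fun g => (B i).coord p (ρX i g (B i q))) := by
        funext g
        rw [Finset.sum_apply]
        conv_lhs => rw [← (B i).sum_repr (ρX i g w)]
        rw [map_sum]
        refine Finset.sum_congr rfl fun p _ => ?_
        rw [Finset.sum_apply, map_smul]
        conv_lhs => rw [← (B i).sum_repr w]
        simp only [map_sum, map_smul, Finsupp.coe_finsetSum, Finset.sum_apply, smul_eq_mul,
          Pi.smul_apply, Finset.sum_mul, Basis.coord_apply, Finsupp.smul_apply]
        refine Finset.sum_congr rfl fun q _ => ?_
        ring
      rw [e]
      refine Subalgebra.sum_mem _ fun p _ => Subalgebra.sum_mem _ fun q _ =>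
        Subalgebra.smul_mem _ (Algebra.subset_adjoin ?_) _
      exact Set.mem_iUnion.2 ⟨i, Set.mem_iUnion.2 ⟨p, Set.mem_iUnion.2 ⟨q, rfl⟩⟩⟩
    · apply Algebra.adjoin_le
      intro f hf
      obtain ⟨i, hf⟩ := Set.mem_iUnion.1 hf
      obtain ⟨p, hf⟩ := Set.mem_iUnion.1 hf
      obtain ⟨q, hf⟩ := Set.mem_iUnion.1 hf
      rw [Set.mem_singleton_iff.1 hf]
      exact Oalg_isO ρX i _ _
  rw [this]
  exact isNoetherianRing_of_fg (Subalgebra.fg_def.2 ⟨s, hs, rfl⟩)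

lemma Oalg_lift (d : Oalg ρX →ₗ[k] k)
    (hd : ∀ a b, d (a * b) = ev _ 1 a * d b + ev _ 1 b * d a) :
    ∃ D ∈ LieD (Oalg_stab ρX), ∀ a, ev _ 1 (D a) = d a := by
  have hS := Oalg_stab ρX
  have hmem : ∀ f : Oalg ρX, (fun g => d (Lop hS g f)) ∈ Oalg ρX := by
    intro f
    induction f using Oalg_induction with
    | hmem i l w =>
      let τ : X i := (evalEquiv k (X i)).symm (d ∘ₗ (mc (Oalg_isO ρX i)).flip w)
      have hτ : ∀ l', l' τ = d (mc (Oalg_isO ρX i) l' w) := fun l' =>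
        apply_evalEquiv_symm_apply ..
      convert Oalg_isO ρX i l τ using 2 with g
      have := hτ (l ∘ₗ ρX i g)
      rw [LinearMap.comp_apply] at this
      rw [this]
      congr 1
      ext x
      simp
    | hc c => exact Subalgebra.algebraMap_mem _ (d (algebraMap k _ c))
    | hadd a b ha hb =>
      convert Subalgebra.add_mem _ ha hb using 1
      funext g
      simp
    | hmul a b ha hb =>
      convert Subalgebra.add_mem _ (Subalgebra.mul_mem _ a.2 hb) (Subalgebra.mul_mem _ b.2 ha) using 1
      funext g
      rw [Lop_mul, hd]
      simp
  let D : Module.End k (Oalg ρX) :=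
    { toFun := fun f => ⟨fun g => d (Lop hS g f), hmem f⟩
      map_add' := fun a b => by ext g; simp
      map_smul' := fun c a => by ext g; simp }
  have hDa : ∀ f g, (D f).1 g = d (Lop hS g f) := fun _ _ => rfl
  refine ⟨D, ⟨fun a b => ?_, fun g f => ?_⟩, fun a => ?_⟩
  · ext g
    change (D (a * b)).1 g = a.1 g * (D b).1 g + b.1 g * (D a).1 g
    rw [hDa, hDa, hDa, Lop_mul, hd]
    simp
  · ext x
    rw [Lop_apply, hDa, hDa]
    congr 1
    ext y
    simp [mul_assoc]
  · rw [ev_apply, hDa]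
    congr 1
    ext y
    simp

lemma Oalg_good [IsAlgClosed k] : Good (Oalg_stab ρX) (LieD (Oalg_stab ρX)) :=
  ⟨le_rfl, fun g _ hD => LieD.conj hD g, fun _ hD _ hE => LieD.bracket hD hE,
    fun D hD φ => exists_replica hD (Oalg_top ρX D hD) φ⟩

/-- The reductivity statement. -/
lemma reductive [IsAlgClosed k] [CharZero k] (hirr : ∀ i, Irr (ρX i))
    (T : Type) [AddCommGroup T] [Module k T] [FiniteDimensional k T]
    (ρ : Representation k G T) (h : IsO (Oalg ρX) ρ) (p : Dual k T)
    (hp : ∀ g t, p (ρ g t) = p t) (hp0 : p ≠ 0) : ∃ t, p t ≠ 0 ∧ ∀ g, ρ g t = t := by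
  have := Oalg_noeth ρX
  have H : Setup (Oalg_stab ρX) (Oalg_isO ρX) := ⟨hirr, Oalg_good ρX, Oalg_faithful ρX⟩
  exact exists_invariant H
    (fun T _ _ _ ρ h h0 => rep_finite (Oalg_stab ρX) (Oalg_lift ρX) T ρ h h0) _ T ρ h p rfl hp hp0

end Oalg
end Chev

namespace Chev
open Module

section closure
variable {k : Type} [Field k] {G : Type} [Group G] {O : Subalgebra k (G → k)}
variable {A B : Type} [AddCommGroup A] [Module k A] [FiniteDimensional k A]
  [AddCommGroup B] [Module k B] [FiniteDimensional k B]
  {ρ : Representation k G A} {σ : Representation k G B}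

lemma isO_tprod (hA : IsO O ρ) (hB : IsO O σ) : IsO O (ρ.tprod σ) := by
  classical
  intro l t
  induction t using TensorProduct.induction_on with
  | zero =>
    simp only [map_zero]
    exact Subalgebra.zero_mem O
  | add x y hx hy =>
    convert Subalgebra.add_mem _ hx hy using 1
    funext g; simp
  | tmul a b =>
    let e := Module.finBasis k A
    let f := Module.finBasis k B
    have key : (fun g => l (ρ.tprod σ g (a ⊗ₜ[k] b))) = ∑ i, ∑ j, l (e i ⊗ₜ[k] f j) •
        ((fun g => e.coord i (ρ g a)) * (fun g => f.coord j (σ g b))) := by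
      funext g
      rw [Representation.tprod_apply, TensorProduct.map_tmul]
      conv_lhs => rw [← e.sum_repr (ρ g a), ← f.sum_repr (σ g b)]
      simp only [TensorProduct.sum_tmul, TensorProduct.tmul_sum, map_sum, Finset.sum_apply]
      rw [Finset.sum_comm]
      refine Finset.sum_congr rfl fun i _ => Finset.sum_congr rfl fun j _ => ?_
      simp only [TensorProduct.smul_tmul_smul, map_smul, Pi.smul_apply, Pi.mul_apply, smul_eq_mul,
        Basis.coord_apply]
      ring
    rw [key]
    exact Subalgebra.sum_mem _ fun i _ => Subalgebra.sum_mem _ fun j _ =>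
      Subalgebra.smul_mem _ (Subalgebra.mul_mem _ (hA _ _) (hB _ _)) _

lemma isO_linHom (hinv : ∀ f ∈ O, (fun g => f g⁻¹) ∈ O) (hA : IsO O ρ) (hB : IsO O σ) :
    IsO O (ρ.linHom σ) := by
  classical
  intro l t
  let e := Module.finBasis k A
  let f := Module.finBasis k B
  have hexp : ∀ F : A →ₗ[k] B, F = ∑ j, ∑ i, f.coord i (F (e j)) • (e.coord j).smulRight (f i) := by
    intro F
    apply e.ext
    intro j'
    simp only [LinearMap.sum_apply, LinearMap.smul_apply, LinearMap.smulRight_apply,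
      Basis.coord_apply, Basis.repr_self]
    rw [Finset.sum_eq_single j']
    · simp [f.sum_repr]
    · intro b _ hb
      simp [Finsupp.single_eq_of_ne hb]
    · simp
  have key : (fun g => l (ρ.linHom σ g t)) = ∑ j, ∑ i, l ((e.coord j).smulRight (f i)) •
      ∑ m, ((fun g => f.coord i (σ g (t (e m)))) * (fun g => e.coord m (ρ g⁻¹ (e j)))) := by
    funext g
    conv_lhs => rw [hexp (ρ.linHom σ g t)]
    simp only [map_sum, Finset.sum_apply, map_smul]
    refine Finset.sum_congr rfl fun j _ => Finset.sum_congr rfl fun i _ => ?_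
    rw [Pi.smul_apply, smul_eq_mul, smul_eq_mul, mul_comm, Finset.sum_apply]
    congr 1
    rw [Representation.linHom_apply, LinearMap.comp_apply, LinearMap.comp_apply]
    conv_lhs => rw [← e.sum_repr (ρ g⁻¹ (e j))]
    simp only [map_sum, map_smul, Pi.mul_apply, smul_eq_mul, Basis.coord_apply]
    exact Finset.sum_congr rfl fun m _ => mul_comm _ _
  rw [key]
  exact Subalgebra.sum_mem _ fun i _ => Subalgebra.sum_mem _ fun j _ =>
      Subalgebra.smul_mem _ (Subalgebra.sum_mem _ fun m _ =>
        Subalgebra.mul_mem _ (hB _ _) (hinv _ (hA (e.coord m) (e i)))) _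

lemma irr_dual (h : Irr ρ) : Irr ρ.dual := by
  have := h.nontriv
  refine ⟨inferInstance, fun S hS => ?_⟩
  have h1 : ∀ g, ∀ t ∈ S.dualCoannihilator, ρ g t ∈ S.dualCoannihilator := by
    intro g t ht
    rw [Submodule.mem_dualCoannihilator] at ht ⊢
    intro φ hφ
    have := ht _ (hS g⁻¹ φ hφ)
    simpa [Representation.dual_apply, Module.Dual.transpose_apply] using this
  rcases h.eq _ h1 with h2 | h2
  · right
    rw [← Subspace.dualCoannihilator_dualAnnihilator_eq (W := S), h2, Submodule.dualAnnihilator_bot]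
  · left
    rw [← Subspace.dualCoannihilator_dualAnnihilator_eq (W := S), h2, Submodule.dualAnnihilator_top]

end closure

section pairing
variable {k : Type} [Field k] [IsAlgClosed k] [CharZero k] {G : Type} [Group G]
variable {ι : Type} [Fintype ι] {X : ι → Type} [∀ i, AddCommGroup (X i)]
    [∀ i, Module k (X i)] [∀ i, FiniteDimensional k (X i)] {ρX : ∀ i, Representation k G (X i)}
variable {A B : Type} [AddCommGroup A] [Module k A] [FiniteDimensional k A]
  [AddCommGroup B] [Module k B] [FiniteDimensional k B]
  {ρ : Representation k G A} {σ : Representation k G B}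

lemma exists_pair (hirr : ∀ i, Irr (ρX i)) (hinv : ∀ f ∈ Oalg ρX, (fun g => f g⁻¹) ∈ Oalg ρX)
    (hA : IsO (Oalg ρX) ρ) (hB : IsO (Oalg ρX) σ) (f : A →ₗ[k] B)
    (hf : ∀ g, f ∘ₗ ρ g = σ g ∘ₗ f) (hf0 : f ≠ 0) :
    ∃ t : B →ₗ[k] A, (∀ g, t ∘ₗ σ g = ρ g ∘ₗ t) ∧ LinearMap.trace k A (t ∘ₗ f) ≠ 0 := by
  let p : Dual k (B →ₗ[k] A) := LinearMap.trace k A ∘ₗ LinearMap.lcomp k A f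
  have hp : ∀ t, p t = LinearMap.trace k A (t ∘ₗ f) := fun t => rfl
  obtain ⟨t, ht, hg⟩ := reductive ρX hirr (B →ₗ[k] A) (σ.linHom ρ) (isO_linHom hinv hB hA) p
    (by
      intro g t
      rw [hp, hp, Representation.linHom_apply]
      have e : (ρ g ∘ₗ t ∘ₗ σ g⁻¹) ∘ₗ f = ρ g * ((t ∘ₗ f) * ρ g⁻¹) := by
        rw [LinearMap.comp_assoc, LinearMap.comp_assoc, ← hf]; rfl
      rw [e, LinearMap.trace_mul_comm, mul_assoc, ← map_mul]
      simp)
    (by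
      intro h0
      apply hf0
      ext a
      apply ext_dual (k := k)
      intro l
      have h1 : p (l.smulRight a) = 0 := by rw [h0]; rfl
      rw [hp] at h1
      have e : l.smulRight a ∘ₗ f = (l ∘ₗ f).smulRight a := rfl
      have e2 : (l ∘ₗ f).smulRight a = dualTensorHom k A A ((l ∘ₗ f) ⊗ₜ a) := by
        ext x; simp
      rw [e, e2, LinearMap.trace_eq_contract_apply, contractLeft_apply] at h1
      simpa using h1)
  refine ⟨t, fun g => ?_, ht⟩
  have := hg g
  rw [Representation.linHom_apply] at this
  conv_lhs => rw [← this]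
  rw [LinearMap.comp_assoc, LinearMap.comp_assoc]
  have e : σ g⁻¹ ∘ₗ σ g = LinearMap.id := by
    change σ g⁻¹ * σ g = 1
    rw [← map_mul]; simp
  rw [e, LinearMap.comp_id]

end pairing

section fdrep
variable {k : Type} [Field k] {G : Type} [Group G]

/-- underlying linear map -/
def toLin {A B : FDRep k G} (f : A ⟶ B) : A →ₗ[k] B := f.hom.hom.hom

lemma toLin_comm {A B : FDRep k G} (f : A ⟶ B) (g : G) :
    toLin f ∘ₗ A.ρ g = B.ρ g ∘ₗ toLin f := by
  have := congrArg (fun q => q.hom.hom) (f.comm g)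
  exact this

/-- morphism from linear map -/
def ofLin {A B : FDRep k G} (f : A →ₗ[k] B) (h : ∀ g, f ∘ₗ A.ρ g = B.ρ g ∘ₗ f) : A ⟶ B :=
  ⟨InducedCategory.homMk (ModuleCat.ofHom f), fun g => by
    ext1; ext1
    exact LinearMap.congr_fun (h g) _⟩

lemma toLin_ofLin {A B : FDRep k G} (f : A →ₗ[k] B) (h : ∀ g, f ∘ₗ A.ρ g = B.ρ g ∘ₗ f) :
    toLin (ofLin f h) = f := rfl

lemma toLin_inj {A B : FDRep k G} (f g : A ⟶ B) (h : toLin f = toLin g) : f = g := by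
  ext1; ext1; ext1
  exact LinearMap.congr_fun h _

lemma toLin_comp {A B C : FDRep k G} (f : A ⟶ B) (g : B ⟶ C) :
    toLin (f ≫ g) = toLin g ∘ₗ toLin f := rfl

lemma irr_of_simple (A : FDRep k G) (h : Simple A) : Irr A.ρ := by
  refine ⟨?_, fun S hS => ?_⟩
  · by_contra hcon
    rw [not_nontrivial_iff_subsingleton] at hcon
    apply Simple.not_isZero A
    rw [Limits.IsZero.iff_id_eq_zero]
    apply toLin_inj
    ext x
    exact Subsingleton.elim _ _
  · let Y : FDRep k G := FDRep.of (subRep (T := A) A.ρ S hS)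
    let i : Y ⟶ A := ofLin (A := Y) (B := A) S.subtype (fun g => rfl)
    have hi : Mono i := by
      constructor
      intro Z a b hab
      apply toLin_inj
      have h1 := congrArg toLin hab
      rw [toLin_comp, toLin_comp] at h1
      ext x
      exact congrArg (fun q => q x) h1
    by_cases h0 : i = 0
    · left
      rw [eq_bot_iff]
      intro x hx
      have h1 : toLin i = 0 := by rw [h0]; rfl
      exact congrArg (fun q => q (⟨x, hx⟩ : S)) h1
    · right
      have : IsIso i := isIso_of_mono_of_nonzero h0
      rw [eq_top_iff]
      rintro x -
      have h1 := congrArg toLin (IsIso.inv_hom_id i)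
      rw [toLin_comp] at h1
      have h2 : toLin i (toLin (inv i) x) = x := congrArg (fun q => q x) h1
      rw [← h2]
      exact (show S from toLin (inv i) x).2

lemma finrank_adj (X Y Z : FDRep k G) :
    finrank k (X ⊗ Y ⟶ Z) = finrank k (Y ⟶ Z ⊗ Xᘁ) := by
  let e : (X ⊗ Y ⟶ Z) ≃ (Y ⟶ Z ⊗ Xᘁ) :=
    ((β_ Y X).symm.homFromEquiv).trans (tensorRightHomEquiv Y X Xᘁ Z)
  let e' : (X ⊗ Y ⟶ Z) ≃ₗ[k] (Y ⟶ Z ⊗ Xᘁ) :=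
    { e with
      map_add' := by
        intro a b
        simp [e, tensorRightHomEquiv]
      map_smul' := by
        intro a b
        simp [e, tensorRightHomEquiv] }
  exact e'.finrank_eq

variable [IsAlgClosed k] [CharZero k]

lemma finrank_le {ι : Type} [Fintype ι] {X : ι → Type} [∀ i, AddCommGroup (X i)]
    [∀ i, Module k (X i)] [∀ i, FiniteDimensional k (X i)] {ρX : ∀ i, Representation k G (X i)}
    (hirr : ∀ i, Irr (ρX i)) (hinv : ∀ f ∈ Oalg ρX, (fun g => f g⁻¹) ∈ Oalg ρX)
    (A B : FDRep k G)
    (hA : IsO (Oalg ρX) A.ρ) (hB : IsO (Oalg ρX) B.ρ) :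
    finrank k (A ⟶ B) ≤ finrank k (B ⟶ A) := by
  let m : (A ⟶ B) →ₗ[k] Dual k (B ⟶ A) :=
    LinearMap.mk₂ k (fun f t => LinearMap.trace k A (toLin t ∘ₗ toLin f))
      (by
        intro f f' t
        rw [← map_add, ← LinearMap.comp_add]; rfl)
      (by
        intro c f t
        rw [← map_smul, ← LinearMap.comp_smul]; rfl)
      (by
        intro f t t'
        rw [← map_add, ← LinearMap.add_comp]; rfl)
      (by
        intro c f t
        rw [← map_smul, ← LinearMap.smul_comp]; rfl)
  have hm : Function.Injective m := by
    rw [injective_iff_map_eq_zero]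
    intro f hf
    by_contra hf0
    obtain ⟨t, ht, htr⟩ := exists_pair hirr hinv hA hB (toLin f) (toLin_comm f)
      (fun h => hf0 (toLin_inj _ _ h))
    exact htr (congrArg (fun q => q (ofLin t ht)) hf)
  calc finrank k (A ⟶ B) ≤ finrank k (Dual k (B ⟶ A)) := LinearMap.finrank_le_finrank_of_injective hm
    _ = _ := Subspace.dual_finrank_eq

lemma finrank_symm (L N T : FDRep k G) (hL : Simple L) (hN : Simple N) (hT : Simple T) :
    finrank k (L ⊗ N ⟶ T) = finrank k (T ⟶ L ⊗ N) := by
  let F : Fin 3 → FDRep k G := ![L, N, T]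
  have hF : ∀ i, Irr (F i).ρ := by
    intro i
    fin_cases i
    · exact irr_of_simple L hL
    · exact irr_of_simple N hN
    · exact irr_of_simple T hT
  let E : Fin 3 ⊕ Fin 3 → FDRep k G :=
    Sum.elim F (fun i => FDRep.of (Representation.dual (V := F i) (F i).ρ))
  let ρX : ∀ i, Representation k G (E i) := fun i => (E i).ρ
  have hirr : ∀ i, Irr (ρX i) := by
    rintro (i | i)
    · exact hF i
    · exact irr_dual (A := F i) (hF i)
  have hinv : ∀ f ∈ Oalg ρX, (fun g => f g⁻¹) ∈ Oalg ρX := by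
    intro f hf
    refine Oalg_inv ρX ?_ f hf
    rintro (i | i) l w
    · exact Oalg_isO ρX (Sum.inr i) (Dual.eval k (F i) w) l
    · obtain ⟨w', hw'⟩ := (evalEquiv k (F i)).surjective l
      convert Oalg_isO ρX (Sum.inl i) w w' using 2 with g
      rw [← hw']
      change (show Dual k (F i) from w) ((F i).ρ g⁻¹⁻¹ w') = _
      rw [inv_inv]
      rfl
  have hO : ∀ i, IsO (Oalg ρX) (F i).ρ := fun i => Oalg_isO ρX (Sum.inl i)
  have hLN : IsO (Oalg ρX) (L ⊗ N : FDRep k G).ρ :=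
    isO_tprod (A := L) (B := N) (ρ := L.ρ) (σ := N.ρ) (hO 0) (hO 1)
  exact le_antisymm (finrank_le hirr hinv _ _ hLN (hO 2)) (finrank_le hirr hinv _ _ (hO 2) hLN)

end fdrep
end Chev

theorem not_TMF_of_add (k : Type) [Field k] [IsAlgClosed k] [CharZero k]
    (G : Type) [Group G] (Λ : Type) [AddCommMonoid Λ]
    (V : Λ → FDRep k G)
    (hsimple : ∀ l : Λ, Simple (V l))
    (hdistinct : ∀ a b : Λ, Nonempty (V a ≅ V b) → a = b)
    (hprev : ∀ a b c θ : Λ, Module.finrank k (V θ ⟶ V a ⊗ (V b)ᘁ) ≤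
      Module.finrank k (V θ ⟶ V (a + c) ⊗ (V (b + c))ᘁ))
    (lam nu θ : Λ)
    (h2 : 2 ≤ Module.finrank k (V θ ⟶ V lam ⊗ V nu)) :
    ∀ mu : Λ, 2 ≤ Module.finrank k (V (θ + mu) ⟶ V (lam + mu) ⊗ V nu) := by
  intro mu
  rw [← Chev.finrank_symm _ _ _ (hsimple _) (hsimple _) (hsimple _), Chev.finrank_adj] at h2 ⊢
  exact h2.trans (hprev θ lam mu nu)
end
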